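/- Let (G, P, L) be a minimum counterexample to the following statement, minimizing |V(G)| + |E(G)| and then the sum of the list sizes: 'Every plane graph G with no 4-cycle, with outer face F, subpath P ⊆ F with at most three vertices, and (*,1)-list assignment L satisfying conditions (i)–(vi) is L-colorable.' Then the outer cycle F has no separating 2-chord v0v1v2 with |L(v2)| = 2 such that v0 is not a middle vertex of P. -/

import Mathlib

open Set

namespace ChoosSep

/-- `G` has a cycle of length `n`. -/
def HasCycleLen {V : Type} (G : SimpleGraph V) (n : ℕ) : Prop :=
  ∃ (v : V) (c : G.Walk v v), c.IsCycle ∧ c.length = n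

/-- `G` has a proper coloring choosing each color from the list `L v`. -/
def ColorableWith {V : Type} (G : SimpleGraph V) (L : V → Finset ℕ) : Prop :=
  ∃ φ : V → ℕ, (∀ v, φ v ∈ L v) ∧ ∀ ⦃u v⦄, G.Adj u v → φ u ≠ φ v

/-- `G` is `(k,d)`-choosable: it has an `L`-coloring for every list assignment
giving each vertex at least `k` colors and any two adjacent vertices at most `d`
common colors. -/
def Choosable {V : Type} (G : SimpleGraph V) (k d : ℕ) : Prop :=
  ∀ L : V → Finset ℕ, (∀ v, k ≤ (L v).card) →
    (∀ ⦃u v⦄, G.Adj u v → ((L u) ∩ (L v)).card ≤ d) →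
    ColorableWith G L

/-- The closed straight segment between two points of the plane. -/
def seg (x y : ℝ × ℝ) : Set (ℝ × ℝ) := segment ℝ x y

/-- A straight-line plane embedding of `G`: vertices go to distinct points, edges are
drawn as straight segments, two distinct edges meet only in common endpoints, and no
vertex lies on the drawing of an edge it does not belong to.  By Fáry's theorem a
finite simple graph admits such an embedding iff it is planar. -/
structure PlaneEmb {V : Type} (G : SimpleGraph V) where
  pos : V → ℝ × ℝ
  inj : Function.Injective pos
  edges_meet : ∀ ⦃a b c d : V⦄, G.Adj a b → G.Adj c d → s(a, b) ≠ s(c, d) →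
    seg (pos a) (pos b) ∩ seg (pos c) (pos d) ⊆ ({pos a, pos b} ∩ {pos c, pos d} : Set (ℝ × ℝ))
  vertex_off : ∀ ⦃a b v : V⦄, G.Adj a b → v ≠ a → v ≠ b → pos v ∉ seg (pos a) (pos b)

/-- `G` is planar: it admits a plane embedding. -/
def IsPlanar {V : Type} (G : SimpleGraph V) : Prop := Nonempty (PlaneEmb G)

variable {V : Type} {G : SimpleGraph V}

/-- The drawing of the graph in the plane: all vertex points and all edge segments. -/
def PlaneEmb.drawing (E : PlaneEmb G) : Set (ℝ × ℝ) :=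
  Set.range E.pos ∪ ⋃ (a : V) (b : V) (_ : G.Adj a b), seg (E.pos a) (E.pos b)

/-- A face of the embedding: a connected component of the complement of the drawing. -/
def PlaneEmb.IsFace (E : PlaneEmb G) (C : Set (ℝ × ℝ)) : Prop :=
  ∃ q, q ∉ E.drawing ∧ C = connectedComponentIn E.drawingᶜ q

/-- The outer face: the unbounded face. -/
def PlaneEmb.IsOuterFace (E : PlaneEmb G) (C : Set (ℝ × ℝ)) : Prop :=
  E.IsFace C ∧ ¬ Bornology.IsBounded C

/-- The vertices lying on the boundary of the face `C`. -/
def PlaneEmb.onFace (E : PlaneEmb G) (C : Set (ℝ × ℝ)) : Set V :=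
  {v | E.pos v ∈ closure C}

/-- An edge of `G` lying on the boundary of the face `C`. -/
def PlaneEmb.BoundaryEdge (E : PlaneEmb G) (C : Set (ℝ × ℝ)) (u v : V) : Prop :=
  G.Adj u v ∧ seg (E.pos u) (E.pos v) ⊆ closure C

/-- `C` is a 3-face with (mutually adjacent) incident vertices `x`, `y`, `z`. -/
def PlaneEmb.IsTriFace (E : PlaneEmb G) (C : Set (ℝ × ℝ)) (x y z : V) : Prop :=
  E.IsFace C ∧ G.Adj x y ∧ G.Adj y z ∧ G.Adj x z ∧
    frontier C = seg (E.pos x) (E.pos y) ∪ seg (E.pos y) (E.pos z) ∪ seg (E.pos x) (E.pos z)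

/-- `C` is a 4-face with incident 4-cycle `w x y z`. -/
def PlaneEmb.IsQuadFace (E : PlaneEmb G) (C : Set (ℝ × ℝ)) (w x y z : V) : Prop :=
  E.IsFace C ∧ G.Adj w x ∧ G.Adj x y ∧ G.Adj y z ∧ G.Adj z w ∧ w ≠ y ∧ x ≠ z ∧
    frontier C = seg (E.pos w) (E.pos x) ∪ seg (E.pos x) (E.pos y) ∪
      seg (E.pos y) (E.pos z) ∪ seg (E.pos z) (E.pos w)

/-- `x z1 y z2` is a diamond: a 4-cycle formed by two adjacent 3-faces
`x y z1` and `x y z2` sharing the edge `x y`. -/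
def PlaneEmb.IsDiamond (E : PlaneEmb G) (x z1 y z2 : V) : Prop :=
  z1 ≠ z2 ∧ ∃ C1 C2 : Set (ℝ × ℝ), C1 ≠ C2 ∧ E.IsTriFace C1 x y z1 ∧ E.IsTriFace C2 x y z2

/-- The union of the three sides of the triangle `a b c`. -/
def triBoundary (a b c : ℝ × ℝ) : Set (ℝ × ℝ) := seg a b ∪ seg b c ∪ seg a c

/-- The open interior region of the triangle `a b c`: points off the triangle whose
connected component in the complement of the triangle is bounded. -/
def triInterior (a b c : ℝ × ℝ) : Set (ℝ × ℝ) :=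
  {p | p ∉ triBoundary a b c ∧
    Bornology.IsBounded (connectedComponentIn (triBoundary a b c)ᶜ p)}

/-- The degree of a vertex. -/
noncomputable def deg (G : SimpleGraph V) (v : V) : ℕ := Nat.card {u : V // G.Adj v u}

/-- `G` is 2-connected: connected and with no cutvertex. -/
def TwoConnected (G : SimpleGraph V) : Prop :=
  G.Connected ∧ ∀ v : V, (G.induce {u : V | u ≠ v}).Connected

/-- A configuration for Theorem 6: a plane graph with no 4-cycle, outer face `F`, a
precolored subpath `P` of the outer face with at most three vertices, and a
`(*,1)`-list assignment `L` satisfying conditions (i)–(vi). -/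
structure Cfg4 where
  n : ℕ
  G : SimpleGraph (Fin n)
  E : PlaneEmb G
  F : Set (ℝ × ℝ)
  P : List (Fin n)
  L : Fin n → Finset ℕ

namespace Cfg4

/-- All hypotheses of Theorem 6 hold for the configuration. -/
def Valid (C : Cfg4) : Prop :=
  (¬ HasCycleLen C.G 4) ∧
  C.E.IsOuterFace C.F ∧
  C.P.Nodup ∧ C.P.length ≤ 3 ∧
  (∀ v ∈ C.P, v ∈ C.E.onFace C.F) ∧
  C.P.Chain' (C.E.BoundaryEdge C.F) ∧
  (∀ v, 1 ≤ (C.L v).card) ∧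
  (∀ ⦃u v⦄, C.G.Adj u v → ((C.L u) ∩ (C.L v)).card ≤ 1) ∧
  (∀ v, v ∉ C.E.onFace C.F → 3 ≤ (C.L v).card) ∧
  (∀ v ∈ C.E.onFace C.F, v ∉ C.P → 2 ≤ (C.L v).card) ∧
  (∀ v ∈ C.P, (C.L v).card = 1) ∧
  (∀ ⦃u v⦄, C.G.Adj u v → (C.L u).card = 2 → (C.L v).card ≠ 2) ∧
  (∃ φ : Fin C.n → ℕ, (∀ v ∈ C.P, φ v ∈ C.L v) ∧
    ∀ ⦃u v⦄, u ∈ C.P → v ∈ C.P → C.G.Adj u v → φ u ≠ φ v) ∧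
  (∀ x, (C.L x).card = 2 → ∀ u ∈ C.P, ∀ v ∈ C.P, u ≠ v →
    C.G.Adj x u → C.G.Adj x v → False)

/-- The configuration admits an `L`-coloring. -/
def Colorable (C : Cfg4) : Prop := ColorableWith C.G C.L

/-- The quantity `|V(G)| + |E(G)|`. -/
noncomputable def measure (C : Cfg4) : ℕ := C.n + Nat.card ↥C.G.edgeSet

/-- The sum of the sizes of the lists. -/
def listSum (C : Cfg4) : ℕ := ∑ v, (C.L v).card

/-- `C` is a minimum counterexample to Theorem 6: it satisfies the hypotheses, has no
`L`-coloring, and minimizes `|V(G)| + |E(G)|` and then the sum of the list sizes among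
all such counterexamples. -/
def MinCounterexample (C : Cfg4) : Prop :=
  C.Valid ∧ ¬ C.Colorable ∧
    ∀ D : Cfg4, D.Valid → ¬ D.Colorable →
      C.measure ≤ D.measure ∧ (D.measure = C.measure → C.listSum ≤ D.listSum)

/-- `uv` is a chord of the outer cycle: an edge between two vertices of the outer
face that is not an edge of the outer face. -/
def IsChord (C : Cfg4) (u v : Fin C.n) : Prop :=
  C.G.Adj u v ∧ u ∈ C.E.onFace C.F ∧ v ∈ C.E.onFace C.F ∧ ¬ C.E.BoundaryEdge C.F u v

/-- A chord `uv` is bad if one of its `Q`-components is a triangle `u v x` with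
`|L(x)| = 2`: i.e. there is an `L2`-vertex `x` with `ux` and `xv` edges of the outer
cycle such that the triangle `u x v` encloses no vertex of `G`. -/
def IsBadChord (C : Cfg4) (u v : Fin C.n) : Prop :=
  C.IsChord u v ∧ ∃ x : Fin C.n, (C.L x).card = 2 ∧
    C.G.Adj u x ∧ C.G.Adj x v ∧
    C.E.BoundaryEdge C.F u x ∧ C.E.BoundaryEdge C.F x v ∧
    ∀ w : Fin C.n, C.E.pos w ∉ triInterior (C.E.pos u) (C.E.pos x) (C.E.pos v)

/-- `v0 v1 v2` is a 2-chord of the outer cycle. -/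
def Is2Chord (C : Cfg4) (v0 v1 v2 : Fin C.n) : Prop :=
  C.G.Adj v0 v1 ∧ C.G.Adj v1 v2 ∧ v0 ≠ v2 ∧
    v0 ∈ C.E.onFace C.F ∧ v2 ∈ C.E.onFace C.F ∧ v1 ∉ C.E.onFace C.F

/-- A 2-chord `v0 v1 v2` is separating if `v0 v2` is not an edge of the outer cycle. -/
def IsSep2Chord (C : Cfg4) (v0 v1 v2 : Fin C.n) : Prop :=
  C.Is2Chord v0 v1 v2 ∧ ¬ C.E.BoundaryEdge C.F v0 v2

/-- `v` is a middle vertex: it has degree two in the path `P`. -/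
def IsMiddle (C : Cfg4) (v : Fin C.n) : Prop :=
  ∃ a b, C.P = [a, v, b]

/-- `v0 v1 v2` is a path on the outer cycle `F`. -/
def IsOuterPath (C : Cfg4) (v0 v1 v2 : Fin C.n) : Prop :=
  v0 ≠ v2 ∧ C.E.BoundaryEdge C.F v0 v1 ∧ C.E.BoundaryEdge C.F v1 v2

end Cfg4

/-- The plane `ℝ × ℝ` as complex numbers. -/
def toC (p : ℝ × ℝ) : ℂ := ⟨p.1, p.2⟩

lemma continuous_toC : Continuous toC :=
  Complex.equivRealProdCLM.symm.continuous

lemma toC_injective : Function.Injective toC :=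
  Complex.equivRealProd.symm.injective

/-- The ratio `(b - z) / (a - z)`, computed in the complex plane. -/
noncomputable def ratio (a b z : ℝ × ℝ) : ℂ := (toC b - toC z) / (toC a - toC z)

lemma toC_sub_ne {a z : ℝ × ℝ} (h : z ≠ a) : toC a - toC z ≠ 0 :=
  fun h0 => h (toC_injective (sub_eq_zero.1 h0)).symm

lemma ratio_ne_zero {a b z : ℝ × ℝ} (ha : z ≠ a) (hb : z ≠ b) : ratio a b z ≠ 0 :=
  div_ne_zero (toC_sub_ne hb) (toC_sub_ne ha)

lemma ratio_mul {a b c z : ℝ × ℝ} (hb : z ≠ b) :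
    ratio a b z * ratio b c z = ratio a c z := by
  have h1 := toC_sub_ne hb
  rw [ratio, ratio, ratio, mul_comm, div_mul_div_cancel₀ h1]

lemma continuousAt_ratio {a b z : ℝ × ℝ} (ha : z ≠ a) : ContinuousAt (ratio a b) z := by
  refine ContinuousAt.div ?_ ?_ (toC_sub_ne ha)
  · exact (continuous_const.sub continuous_toC).continuousAt
  · exact (continuous_const.sub continuous_toC).continuousAt

lemma left_mem_seg (a b : ℝ × ℝ) : a ∈ seg a b := left_mem_segment ℝ a b

lemma right_mem_seg (a b : ℝ × ℝ) : b ∈ seg a b := right_mem_segment ℝ a b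

lemma ratio_mem_slitPlane {a b z : ℝ × ℝ} (h : z ∉ seg a b) :
    ratio a b z ∈ Complex.slitPlane := by
  by_contra hns
  have ha : z ≠ a := fun e => h (e ▸ left_mem_seg _ _)
  have h1 := toC_sub_ne ha
  rw [Complex.mem_slitPlane_iff, not_or, not_lt, not_not] at hns
  obtain ⟨hre, him⟩ := hns
  set s := -(ratio a b z).re with hs
  have hs0 : 0 ≤ s := by linarith
  have hr : ratio a b z = ((-s : ℝ) : ℂ) := by
    apply Complex.ext <;> simp [hs, him]
  have h2 : toC b - toC z = ((-s : ℝ) : ℂ) * (toC a - toC z) := by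
    rw [← hr, ratio, div_mul_cancel₀ _ h1]
  have hx : b.1 - z.1 = -s * (a.1 - z.1) := by
    have := congrArg Complex.re h2
    simpa [toC] using this
  have hy : b.2 - z.2 = -s * (a.2 - z.2) := by
    have := congrArg Complex.im h2
    simpa [toC] using this
  have hp : 0 < 1 + s := by linarith
  refine h ⟨s / (1 + s), 1 / (1 + s), by positivity, by positivity, by field_simp; ring, ?_⟩
  apply Prod.ext
  · simp only [Prod.fst_add, Prod.smul_fst, smul_eq_mul]
    field_simp
    linarith
  · simp only [Prod.snd_add, Prod.smul_snd, smul_eq_mul]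
    field_simp
    linarith

/-- The principal branch of the complex square root. -/
noncomputable def csqrt (w : ℂ) : ℂ := Complex.exp (Complex.log w / 2)

lemma csqrt_sq {w : ℂ} (h : w ≠ 0) : csqrt w ^ 2 = w := by
  rw [csqrt, ← Complex.exp_nat_mul]
  push_cast
  rw [mul_div_cancel₀ _ two_ne_zero, Complex.exp_log h]

lemma csqrt_ne_zero (w : ℂ) : csqrt w ≠ 0 := Complex.exp_ne_zero _

lemma continuousAt_csqrt {w : ℂ} (h : w ∈ Complex.slitPlane) : ContinuousAt csqrt w :=
  Complex.continuous_exp.continuousAt.comp ((continuousAt_clog h).div_const 2)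

lemma csqrt_im_nonneg {w : ℂ} (h : 0 ≤ w.im) : 0 ≤ (csqrt w).im := by
  have h1 : (csqrt w).im = Real.exp ((Complex.log w / 2).re) * Real.sin (w.arg / 2) := by
    rw [csqrt, Complex.exp_im]
    congr 2
    simp [Complex.log_im]
  rw [h1]
  have := Complex.arg_nonneg_iff.2 h
  have := Complex.arg_le_pi w
  exact mul_nonneg (Real.exp_pos _).le
    (Real.sin_nonneg_of_nonneg_of_le_pi (by linarith) (by linarith))

lemma csqrt_im_nonpos {w : ℂ} (h : w.im < 0) : (csqrt w).im ≤ 0 := by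
  have h1 : (csqrt w).im = Real.exp ((Complex.log w / 2).re) * Real.sin (w.arg / 2) := by
    rw [csqrt, Complex.exp_im]
    congr 2
    simp [Complex.log_im]
  rw [h1]
  have := Complex.arg_neg_iff.2 h
  have := Complex.neg_pi_lt_arg w
  exact mul_nonpos_of_nonneg_of_nonpos (Real.exp_pos _).le
    (Real.sin_nonpos_of_nonpos_of_neg_pi_le (by linarith) (by linarith))

lemma continuousAt_csqrt_ratio {a b z : ℝ × ℝ} (h : z ∉ seg a b) :
    ContinuousAt (fun y => csqrt (ratio a b y)) z :=
  ContinuousAt.comp (f := ratio a b) (continuousAt_csqrt (ratio_mem_slitPlane h))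
    (continuousAt_ratio fun e => h (e ▸ left_mem_seg _ _))

lemma csqrt_ratio_sq {a b z : ℝ × ℝ} (h : z ∉ seg a b) :
    csqrt (ratio a b z) ^ 2 = ratio a b z :=
  csqrt_sq (ratio_ne_zero (fun e => h (e ▸ left_mem_seg _ _))
    (fun e => h (e ▸ right_mem_seg _ _)))

/-- The principal square root of `ratio a b` jumps across the open segment `a b`. -/
lemma not_continuousAt_csqrt_ratio {a b z : ℝ × ℝ} (hab : a ≠ b) (hz : z ∈ openSegment ℝ a b)
    {g : ℝ × ℝ → ℂ} (hg : ContinuousAt g z)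
    (h : ∀ᶠ y in nhds z, y ∉ seg a b → csqrt (ratio a b y) = g y) : False := by
  obtain ⟨p, q, hp, hq, hpq, rfl⟩ := hz
  have hq' : q = 1 - p := by linarith
  subst hq'
  set z := p • a + (1 - p) • b with hzdef
  set c := toC b - toC a with hc
  have hc0 : c ≠ 0 := toC_sub_ne hab
  let y : ℝ → ℝ × ℝ := fun t => z + t • (-(b.2 - a.2), b.1 - a.1)
  have hyc : Continuous y := by fun_prop
  have hy0 : y 0 = z := by simp [y]
  have hya : ∀ t : ℝ, toC a - toC (y t) = (-(1 - p) - t * Complex.I) * c := by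
    intro t
    apply Complex.ext
    · simp [y, toC, hzdef, hc]; ring
    · simp [y, toC, hzdef, hc]; ring
  have hyb : ∀ t : ℝ, toC b - toC (y t) = (p - t * Complex.I) * c := by
    intro t
    apply Complex.ext
    · simp [y, toC, hzdef, hc]; ring
    · simp [y, toC, hzdef, hc]; ring
  have hrat : ∀ t : ℝ, ratio a b (y t) =
      ((t ^ 2 - p * (1 - p) : ℝ) + (t : ℝ) * Complex.I) / (((1 - p) ^ 2 + t ^ 2 : ℝ) : ℂ) := by
    intro t
    have hpos : 0 < (1 - p) ^ 2 + t ^ 2 := by positivity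
    have hne1 : (-(1 - p) - t * Complex.I : ℂ) ≠ 0 := by
      intro h0
      have := congrArg Complex.re h0
      simp at this
      linarith
    have hne2 : (((1 - p) ^ 2 + t ^ 2 : ℝ) : ℂ) ≠ 0 := by exact_mod_cast hpos.ne'
    rw [ratio, hya, hyb, mul_div_mul_right _ _ hc0, div_eq_div_iff hne1 hne2]
    push_cast
    linear_combination (t : ℂ) ^ 2 * Complex.I_sq
  have him : ∀ t : ℝ, (ratio a b (y t)).im = t / ((1 - p) ^ 2 + t ^ 2) := by
    intro t
    rw [hrat, Complex.div_ofReal_im, Complex.add_im, Complex.ofReal_im, zero_add]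
    simp
  have hre : (ratio a b z).re < 0 := by
    rw [← hy0, hrat, Complex.div_ofReal_re]
    apply div_neg_of_neg_of_pos
    · simp only [Complex.add_re, Complex.ofReal_re, Complex.re_ofReal_mul, Complex.I_re]
      nlinarith
    · positivity
  have hseg : ∀ t : ℝ, t ≠ 0 → y t ∉ seg a b := by
    rintro t ht ⟨r, s, hr, hs, hrs, he⟩
    have h1 := hya t
    have hs' : r = 1 - s := by linarith
    subst hs'
    have h2 : toC a - toC (y t) = (-s : ℝ) * c := by
      rw [← he]
      apply Complex.ext
      · simp [toC, hc]; ring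
      · simp [toC, hc]; ring
    rw [h1] at h2
    have := congrArg Complex.im (mul_right_cancel₀ hc0 h2)
    simp at this
    exact ht this
  have hT : Filter.Tendsto y (nhds 0) (nhds z) := by
    have := hyc.tendsto 0
    rwa [hy0] at this
  have hev : ∀ᶠ t in nhds (0 : ℝ), t ≠ 0 → csqrt (ratio a b (y t)) = g (y t) := by
    filter_upwards [hT.eventually h] with t ht h0 using ht (hseg t h0)
  have hgT : Filter.Tendsto (fun t => g (y t)) (nhds 0) (nhds (g z)) := hg.tendsto.comp hT
  have hgim : Filter.Tendsto (fun t => (g (y t)).im) (nhds 0) (nhds (g z).im) :=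
    (Complex.continuous_im.tendsto _).comp hgT
  have h1 : 0 ≤ (g z).im := by
    refine ge_of_tendsto (hgim.mono_left (nhdsWithin_le_nhds (s := Set.Ioi 0))) ?_
    filter_upwards [hev.filter_mono nhdsWithin_le_nhds, self_mem_nhdsWithin] with t ht hpos
    have hpos : 0 < t := hpos
    rw [← ht hpos.ne']
    apply csqrt_im_nonneg
    rw [him]
    positivity
  have h2 : (g z).im ≤ 0 := by
    refine le_of_tendsto (hgim.mono_left (nhdsWithin_le_nhds (s := Set.Iio 0))) ?_
    filter_upwards [hev.filter_mono nhdsWithin_le_nhds, self_mem_nhdsWithin] with t ht hneg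
    have hneg : t < 0 := hneg
    rw [← ht hneg.ne]
    apply csqrt_im_nonpos
    rw [him]
    exact div_neg_of_neg_of_pos hneg (by positivity)
  have hza : z ≠ a := by
    intro h0
    have := hya 0
    rw [hy0, h0, sub_self] at this
    have h3 := (mul_eq_zero.1 this.symm).resolve_right hc0
    have := congrArg Complex.re h3
    simp at this
    linarith
  have h3 : g z ^ 2 = ratio a b z := by
    have t1 : Filter.Tendsto (fun t => g (y t) ^ 2) (nhdsWithin 0 (Set.Ioi 0)) (nhds (g z ^ 2)) :=
      (hgT.pow 2).mono_left nhdsWithin_le_nhds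
    have t2 : Filter.Tendsto (fun t => ratio a b (y t)) (nhdsWithin 0 (Set.Ioi 0))
        (nhds (ratio a b z)) :=
      ((continuousAt_ratio hza).tendsto.comp hT).mono_left nhdsWithin_le_nhds
    refine tendsto_nhds_unique (t1.congr' ?_) t2
    filter_upwards [hev.filter_mono nhdsWithin_le_nhds, self_mem_nhdsWithin] with t ht hpos
    have hpos : 0 < t := hpos
    rw [← ht hpos.ne', csqrt_ratio_sq (hseg t hpos.ne')]
  have h4 : (g z).im = 0 := le_antisymm h2 h1
  have h5 : (ratio a b z).re = (g z).re ^ 2 := by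
    rw [← h3, pow_two, Complex.mul_re, h4]
    ring
  nlinarith [sq_nonneg (g z).re]

/-- Over the complement of a connected open set containing `a` and `b`, the function
`ratio a b` has a continuous square root. -/
lemma exists_sqrt_ratio {F : Set (ℝ × ℝ)} (hF : IsOpen F) (hc : IsPreconnected F)
    {a b : ℝ × ℝ} (ha : a ∈ F) (hb : b ∈ F) :
    ∃ f : ℝ × ℝ → ℂ, ContinuousOn f Fᶜ ∧ ∀ z ∈ Fᶜ, f z ^ 2 = ratio a b z := by
  have base : ∀ x y, seg x y ⊆ F →
      ∃ f : ℝ × ℝ → ℂ, ContinuousOn f Fᶜ ∧ ∀ z ∈ Fᶜ, f z ^ 2 = ratio x y z := by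
    intro x y h
    refine ⟨fun z => csqrt (ratio x y z), fun z hz => ?_, fun z hz => ?_⟩
    · exact (continuousAt_csqrt_ratio fun h' => hz (h h')).continuousWithinAt
    · exact csqrt_ratio_sq fun h' => hz (h h')
  have key := hc.induction₂' (fun x y => x ∈ F → y ∈ F →
    ∃ f : ℝ × ℝ → ℂ, ContinuousOn f Fᶜ ∧ ∀ z ∈ Fᶜ, f z ^ 2 = ratio x y z) ?_ ?_ ha hb
  · exact key ha hb
  · intro x hx
    obtain ⟨r, hr, hball⟩ := Metric.isOpen_iff.1 hF x hx
    have : ∀ᶠ y in nhdsWithin x F, y ∈ Metric.ball x r :=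
      nhdsWithin_le_nhds (Metric.ball_mem_nhds x hr)
    filter_upwards [this] with y hy
    have hs : seg x y ⊆ F :=
      ((convex_ball x r).segment_subset (Metric.mem_ball_self hr) hy).trans hball
    refine ⟨fun _ _ => base x y hs, fun _ _ => base y x ?_⟩
    rw [seg, segment_symm]
    exact hs
  · intro x y w hx hy hw h1 h2 _ _
    obtain ⟨f1, c1, e1⟩ := h1 hx hy
    obtain ⟨f2, c2, e2⟩ := h2 hy hw
    refine ⟨fun z => f1 z * f2 z, c1.mul c2, fun z hz => ?_⟩
    rw [mul_pow, e1 z hz, e2 z hz, ratio_mul]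
    rintro rfl
    exact hz hy

/-- A variant of `exists_sqrt_ratio` for points that see the open set along a segment. -/
lemma exists_sqrt_ratio_of_accessible {F : Set (ℝ × ℝ)} (hF : IsOpen F) (hc : IsPreconnected F)
    {a b a' b' : ℝ × ℝ} (ha : a ∈ F) (hb : b ∈ F) (haa : seg a' a \ {a'} ⊆ F)
    (hbb : seg b' b \ {b'} ⊆ F) :
    ∃ f : ℝ × ℝ → ℂ, ContinuousOn f (Fᶜ \ {a', b'}) ∧
      ∀ z ∈ Fᶜ \ {a', b'}, f z ^ 2 = ratio a' b' z := by
  obtain ⟨f, cf, ef⟩ := exists_sqrt_ratio hF hc ha hb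
  have n1 : ∀ z ∈ Fᶜ \ {a', b'}, z ∉ seg a' a := by
    rintro z ⟨hz, hz'⟩ h
    exact hz (haa ⟨h, fun e => hz' (Or.inl e)⟩)
  have n2 : ∀ z ∈ Fᶜ \ {a', b'}, z ∉ seg b b' := by
    rintro z ⟨hz, hz'⟩ h
    rw [seg, segment_symm] at h
    exact hz (hbb ⟨h, fun e => hz' (Or.inr e)⟩)
  refine ⟨fun z => csqrt (ratio a' a z) * f z * csqrt (ratio b b' z), ?_, ?_⟩
  · intro z hz
    refine ((continuousAt_csqrt_ratio (n1 z hz)).continuousWithinAt.mul ?_).mul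
      (continuousAt_csqrt_ratio (n2 z hz)).continuousWithinAt
    exact (cf z hz.1).mono sdiff_subset
  · intro z hz
    rw [mul_pow, mul_pow, csqrt_ratio_sq (n1 z hz), csqrt_ratio_sq (n2 z hz), ef z hz.1,
      ratio_mul, ratio_mul]
    · rintro rfl
      exact hz.1 hb
    · rintro rfl
      exact hz.1 ha

/-- A connected component of an open set is relatively closed. -/
lemma mem_connectedComponentIn_of_mem_closure {X : Type*} [TopologicalSpace X] {U : Set X}
    {p z : X} (hp : p ∈ U) (hz : z ∈ closure (connectedComponentIn U p)) (hzU : z ∈ U) :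
    z ∈ connectedComponentIn U p := by
  have h1 : IsPreconnected (insert z (connectedComponentIn U p)) :=
    isPreconnected_connectedComponentIn.subset_closure (subset_insert _ _)
      (insert_subset hz subset_closure)
  exact h1.subset_connectedComponentIn (mem_insert_of_mem _ (mem_connectedComponentIn hp))
    (insert_subset hzU (connectedComponentIn_subset _ _)) (mem_insert _ _)

lemma subset_connectedComponentIn_of_inter {X : Type*} [TopologicalSpace X] {U S : Set X}
    {p : X} (hS : IsPreconnected S) (hSU : S ⊆ U)
    (h : (S ∩ connectedComponentIn U p).Nonempty) : S ⊆ connectedComponentIn U p := by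
  obtain ⟨y, hyS, hy⟩ := h
  rw [connectedComponentIn_eq hy]
  exact hS.subset_connectedComponentIn hyS hSU

/-- A bounded component of an open set has a boundary point on every ray from its base point. -/
lemma exists_frontier_on_ray {U : Set (ℝ × ℝ)} (hU : IsOpen U) {p d : ℝ × ℝ} (hp : p ∈ U)
    (hd : d ≠ 0) (hb : Bornology.IsBounded (connectedComponentIn U p)) :
    ∃ t : ℝ, 0 ≤ t ∧ p + t • d ∈ closure (connectedComponentIn U p) ∧ p + t • d ∉ U := by
  by_contra! hcon
  set X := connectedComponentIn U p
  have hcont : Continuous fun t : ℝ => p + t • d := by fun_prop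
  have hR : IsPreconnected ((fun t : ℝ => p + t • d) '' Ici 0) :=
    isPreconnected_Ici.image _ hcont.continuousOn
  have hsub : (fun t : ℝ => p + t • d) '' Ici 0 ⊆ X := by
    refine hR.subset_left_of_subset_union (hU.connectedComponentIn) isClosed_closure.isOpen_compl
      (disjoint_compl_right_iff_subset.2 subset_closure) ?_ ?_
    · rintro _ ⟨t, ht, rfl⟩
      by_cases hc : p + t • d ∈ closure X
      · exact Or.inl (mem_connectedComponentIn_of_mem_closure hp hc (hcon t ht hc))
      · exact Or.inr hc
    · exact ⟨p, ⟨0, by simp, by simp⟩, mem_connectedComponentIn hp⟩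
  obtain ⟨M, hM⟩ := hb.exists_norm_le
  have hd' : 0 < ‖d‖ := norm_pos_iff.2 hd
  have hM0 : 0 ≤ M := (norm_nonneg _).trans (hM p (mem_connectedComponentIn hp))
  set t := (M + ‖p‖ + 1) / ‖d‖
  have ht : 0 ≤ t := by positivity
  have h1 := hM _ (hsub ⟨t, ht, rfl⟩)
  have h2 : ‖t • d‖ = M + ‖p‖ + 1 := by
    rw [norm_smul, Real.norm_of_nonneg ht]
    exact div_mul_cancel₀ _ hd'.ne'
  have h3 : ‖t • d‖ ≤ ‖p + t • d‖ + ‖p‖ := by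
    calc ‖t • d‖ = ‖(p + t • d) - p‖ := by congr 1; abel
      _ ≤ _ := norm_sub_le _ _
  have h1' : ‖p + t • d‖ ≤ M := h1
  linarith

lemma isPreconnected_compl_closedBall {r : ℝ} (hr : 0 ≤ r) :
    IsPreconnected (Metric.closedBall (0 : ℝ × ℝ) r)ᶜ := by
  have hrank : 1 < Module.rank ℝ (ℝ × ℝ) := by
    rw [rank_prod', Module.rank_self]
    norm_num
  have h0 := (isConnected_compl_singleton_of_one_lt_rank hrank (0 : ℝ × ℝ)).isPreconnected
  have : (Metric.closedBall (0 : ℝ × ℝ) r)ᶜ =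
      (fun x : ℝ × ℝ => (1 + r / ‖x‖) • x) '' {0}ᶜ := by
    ext y
    constructor
    · intro hy
      have hy' : r < ‖y‖ := by simpa using hy
      have hy0 : 0 < ‖y‖ := hr.trans_lt hy'
      refine ⟨(1 - r / ‖y‖) • y, ?_, ?_⟩
      · have : 0 < 1 - r / ‖y‖ := by rw [sub_pos, div_lt_one hy0]; exact hy'
        simp only [mem_compl_iff, mem_singleton_iff, smul_eq_zero, not_or]
        exact ⟨this.ne', norm_pos_iff.1 hy0⟩
      · have hp : 0 < 1 - r / ‖y‖ := by rw [sub_pos, div_lt_one hy0]; exact hy'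
        have hn : ‖(1 - r / ‖y‖) • y‖ = ‖y‖ - r := by
          rw [norm_smul, Real.norm_of_nonneg hp.le]
          field_simp
        have hyr : ‖y‖ - r ≠ 0 := by linarith
        simp only [hn, smul_smul]
        have : (1 + r / (‖y‖ - r)) * (1 - r / ‖y‖) = 1 := by
          field_simp
          ring
        rw [this, one_smul]
    · rintro ⟨x, hx, rfl⟩
      have hx0 : 0 < ‖x‖ := norm_pos_iff.2 hx
      have hp : 0 ≤ 1 + r / ‖x‖ := by positivity
      simp only [mem_compl_iff, Metric.mem_closedBall, dist_zero_right, not_le]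
      rw [norm_smul, Real.norm_of_nonneg hp]
      have : (1 + r / ‖x‖) * ‖x‖ = ‖x‖ + r := by field_simp
      linarith
  rw [this]
  refine h0.image _ ?_
  intro x hx
  have hx0 : ‖x‖ ≠ 0 := norm_ne_zero_iff.2 hx
  refine ContinuousAt.continuousWithinAt ?_
  have h1 : ContinuousAt (fun x : ℝ × ℝ => 1 + r / ‖x‖) x :=
    continuousAt_const.add (continuousAt_const.div continuous_norm.continuousAt hx0)
  exact h1.smul (f := fun x : ℝ × ℝ => 1 + r / ‖x‖) (g := fun x : ℝ × ℝ => x) continuousAt_id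

/-- The complement of an unbounded component of the complement of a bounded set is bounded. -/
lemma isBounded_compl_component {D : Set (ℝ × ℝ)} (hD : Bornology.IsBounded D) {q : ℝ × ℝ}
    (hq : ¬ Bornology.IsBounded (connectedComponentIn Dᶜ q)) :
    Bornology.IsBounded (connectedComponentIn Dᶜ q)ᶜ := by
  obtain ⟨M, hM⟩ := hD.subset_closedBall 0
  set r := max M 0
  have hr : 0 ≤ r := le_max_right _ _
  have hDr : D ⊆ Metric.closedBall 0 r :=
    hM.trans (Metric.closedBall_subset_closedBall (le_max_left _ _))
  have hsub : (Metric.closedBall (0 : ℝ × ℝ) r)ᶜ ⊆ connectedComponentIn Dᶜ q := by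
    refine subset_connectedComponentIn_of_inter (isPreconnected_compl_closedBall hr)
      (compl_subset_compl.2 hDr) ?_
    by_contra hne
    refine hq ((Metric.isBounded_closedBall (x := (0 : ℝ × ℝ)) (r := r)).subset ?_)
    intro x hx
    by_contra hx'
    exact hne ⟨x, hx', hx⟩
  exact Metric.isBounded_closedBall.subset (compl_subset_comm.1 hsub)

lemma lineMap_mem_seg {a b : ℝ × ℝ} {t : ℝ} (h0 : 0 ≤ t) (h1 : t ≤ 1) :
    AffineMap.lineMap a b t ∈ seg a b := by
  rw [seg, segment_eq_image_lineMap]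
  exact ⟨t, ⟨h0, h1⟩, rfl⟩

lemma lineMap_mem_openSegment {a b : ℝ × ℝ} {t : ℝ} (h0 : 0 < t) (h1 : t < 1) :
    AffineMap.lineMap a b t ∈ openSegment ℝ a b := by
  rw [openSegment_eq_image_lineMap]
  exact ⟨t, ⟨h0, h1⟩, rfl⟩

lemma continuous_lineMap_plane (a b : ℝ × ℝ) :
    Continuous (fun t : ℝ => (AffineMap.lineMap a b t : ℝ × ℝ)) :=
  AffineMap.lineMap_continuous

lemma seg_comm (a b : ℝ × ℝ) : seg a b = seg b a := segment_symm ℝ a b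

lemma isPreconnected_seg_diff_left (a b : ℝ × ℝ) (hab : a ≠ b) :
    IsPreconnected (seg a b \ {a}) := by
  have : seg a b \ {a} = (fun t : ℝ => (AffineMap.lineMap a b t : ℝ × ℝ)) '' Ioc 0 1 := by
    rw [seg, segment_eq_image_lineMap]
    ext z
    constructor
    · rintro ⟨⟨t, ht, rfl⟩, h⟩
      refine ⟨t, ⟨lt_of_le_of_ne ht.1 ?_, ht.2⟩, rfl⟩
      rintro rfl
      simp at h
    · rintro ⟨t, ht, rfl⟩
      refine ⟨⟨t, ⟨ht.1.le, ht.2⟩, rfl⟩, ?_⟩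
      intro h
      have h' : (AffineMap.lineMap a b t : ℝ × ℝ) = a := h
      rw [AffineMap.lineMap_eq_left_iff] at h'
      rcases h' with h' | h'
      · exact hab h'
      · exact ht.1.ne' h'
  rw [this]
  exact isPreconnected_Ioc.image _ (continuous_lineMap_plane a b).continuousOn

lemma isCompact_seg (a b : ℝ × ℝ) : IsCompact (seg a b) := by
  rw [seg, segment_eq_image_lineMap]
  exact isCompact_Icc.image (continuous_lineMap_plane a b)

lemma isClosed_seg (a b : ℝ × ℝ) : IsClosed (seg a b) := (isCompact_seg a b).isClosed

namespace PlaneEmb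

variable (E : PlaneEmb G)

lemma isCompact_drawing [Finite V] : IsCompact E.drawing := by
  refine (Set.finite_range _).isCompact.union ?_
  refine isCompact_iUnion fun a => isCompact_iUnion fun b => isCompact_iUnion fun _ => ?_
  exact isCompact_seg _ _

lemma pos_mem_drawing (v : V) : E.pos v ∈ E.drawing := Or.inl ⟨v, rfl⟩

lemma seg_subset_drawing {a b : V} (h : G.Adj a b) : seg (E.pos a) (E.pos b) ⊆ E.drawing := by
  intro z hz
  exact Or.inr (mem_iUnion.2 ⟨a, mem_iUnion.2 ⟨b, mem_iUnion.2 ⟨h, hz⟩⟩⟩)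

lemma mem_drawing_iff {z : ℝ × ℝ} : z ∈ E.drawing ↔
    (∃ v, z = E.pos v) ∨ ∃ a b, G.Adj a b ∧ z ∈ seg (E.pos a) (E.pos b) := by
  simp only [drawing, mem_union, mem_range, mem_iUnion, exists_prop, eq_comm (b := z)]

/-- A subset of the drawing made of chosen vertices and edges. -/
def part (S : V → Prop) (R : V → V → Prop) : Set (ℝ × ℝ) :=
  {z | (∃ v, S v ∧ z = E.pos v) ∨ ∃ a b, R a b ∧ z ∈ seg (E.pos a) (E.pos b)}

lemma isClosed_part [Finite V] (S : V → Prop) (R : V → V → Prop) : IsClosed (E.part S R) := by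
  have : E.part S R = (⋃ v ∈ {v | S v}, {E.pos v}) ∪
      ⋃ p ∈ {p : V × V | R p.1 p.2}, seg (E.pos p.1) (E.pos p.2) := by
    ext z
    simp [part]
  rw [this]
  exact ((Set.toFinite _).isClosed_biUnion fun _ _ => isClosed_singleton).union
    ((Set.toFinite _).isClosed_biUnion fun _ _ => isClosed_seg _ _)

variable {E}

lemma isFace_isOpen [Finite V] {F : Set (ℝ × ℝ)} (hF : E.IsFace F) : IsOpen F := by
  obtain ⟨q, _, rfl⟩ := hF
  exact E.isCompact_drawing.isClosed.isOpen_compl.connectedComponentIn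

lemma isFace_disjoint {F : Set (ℝ × ℝ)} (hF : E.IsFace F) {z : ℝ × ℝ} (hz : z ∈ F) :
    z ∉ E.drawing := by
  obtain ⟨q, _, rfl⟩ := hF
  exact connectedComponentIn_subset _ _ hz

lemma isFace_subset {F S : Set (ℝ × ℝ)} (hF : E.IsFace F) (hS : IsPreconnected S)
    (hSD : ∀ z ∈ S, z ∉ E.drawing) (h : (S ∩ F).Nonempty) : S ⊆ F := by
  obtain ⟨q, _, rfl⟩ := hF
  exact subset_connectedComponentIn_of_inter hS hSD h

/-- A vertex on the boundary of a face sees the face along a segment. -/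
lemma exists_accessible [Finite V] {F : Set (ℝ × ℝ)} (hF : E.IsFace F) {v : V}
    (hv : E.pos v ∈ closure F) :
    ∃ a ∈ F, seg (E.pos v) a \ {E.pos v} ⊆ F := by
  set D := E.part (fun u => u ≠ v) (fun a b => G.Adj a b ∧ a ≠ v ∧ b ≠ v)
  have hD : IsClosed D := E.isClosed_part _ _
  have hvD : E.pos v ∉ D := by
    rintro (⟨u, hu, he⟩ | ⟨a, b, ⟨hab, ha, hb⟩, hz⟩)
    · exact hu (E.inj he).symm
    · exact E.vertex_off hab ha.symm hb.symm hz
  obtain ⟨r, hr, hball⟩ := Metric.isOpen_iff.1 hD.isOpen_compl _ hvD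
  obtain ⟨a, haF, hdist⟩ := Metric.mem_closure_iff.1 hv r hr
  have hava : E.pos v ≠ a := by
    rintro rfl
    exact isFace_disjoint hF haF (E.pos_mem_drawing v)
  refine ⟨a, haF, ?_⟩
  have hab : a ∈ Metric.ball (E.pos v) r := by rwa [Metric.mem_ball, dist_comm]
  refine isFace_subset hF (isPreconnected_seg_diff_left _ _ hava) ?_
    ⟨a, ⟨right_mem_seg _ _, hava.symm⟩, haF⟩
  rintro z ⟨hz, hzv⟩ hzD
  have hzb : z ∈ Metric.ball (E.pos v) r :=
    (convex_ball _ _).segment_subset (Metric.mem_ball_self hr) hab hz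
  have hzD' := hball hzb
  have key : ∀ u, G.Adj v u → z ∈ seg (E.pos v) (E.pos u) → False := by
    intro u hvu hzu
    have hur : r ≤ dist (E.pos u) (E.pos v) := by
      by_contra! hlt
      exact hball (a := E.pos u) hlt (Or.inl ⟨u, hvu.ne', rfl⟩)
    rw [seg, segment_eq_image'] at hz hzu
    obtain ⟨t, ht, rfl⟩ := hz
    obtain ⟨s, hs, he⟩ := hzu
    have he : E.pos v + s • (E.pos u - E.pos v) = E.pos v + t • (a - E.pos v) := he
    have ht0 : 0 < t := by
      refine lt_of_le_of_ne ht.1 ?_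
      rintro rfl
      simp at hzv
    have he' : a - E.pos v = (s / t) • (E.pos u - E.pos v) := by
      have h1 := add_left_cancel he
      rw [div_eq_inv_mul, mul_smul, h1, smul_smul, inv_mul_cancel₀ ht0.ne', one_smul]
    have hst0 : 0 ≤ s / t := div_nonneg hs.1 ht.1
    have hst : s / t ≤ 1 := by
      by_contra! hlt
      have h2 : dist a (E.pos v) = s / t * dist (E.pos u) (E.pos v) := by
        rw [dist_eq_norm, he', norm_smul, Real.norm_of_nonneg hst0, dist_eq_norm]
      have h3 : dist a (E.pos v) < r := hab
      nlinarith
    refine isFace_disjoint hF haF (E.seg_subset_drawing hvu ?_)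
    rw [seg, segment_eq_image']
    exact ⟨s / t, ⟨hst0, hst⟩, by simp only [← he']; abel⟩
  rcases E.mem_drawing_iff.1 hzD with ⟨u, rfl⟩ | ⟨b, c, hbc, hzbc⟩
  · by_cases huv : u = v
    · subst huv
      exact hzv rfl
    · exact hzD' (Or.inl ⟨u, huv, rfl⟩)
  · by_cases hb : b = v
    · subst hb
      exact key c hbc hzbc
    · by_cases hc : c = v
      · subst hc
        exact key b hbc.symm (by rwa [seg_comm])
      · exact hzD' (Or.inr ⟨b, c, ⟨hbc, hb, hc⟩, hzbc⟩)

lemma eq_of_mem_seg_of_mem_seg {a b c d : V} (h1 : G.Adj a b) (h2 : G.Adj c d)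
    (hne : s(a, b) ≠ s(c, d)) {z : ℝ × ℝ} (hz1 : z ∈ seg (E.pos a) (E.pos b))
    (hz2 : z ∈ seg (E.pos c) (E.pos d)) :
    (z = E.pos a ∨ z = E.pos b) ∧ (z = E.pos c ∨ z = E.pos d) := by
  have := E.edges_meet h1 h2 hne ⟨hz1, hz2⟩
  simpa using this

lemma ne_of_mem_openSegment {a b z : ℝ × ℝ} (hab : a ≠ b) (hz : z ∈ openSegment ℝ a b) :
    z ≠ a ∧ z ≠ b := by
  constructor
  · rintro rfl
    exact hab (left_mem_openSegment_iff.1 hz)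
  · rintro rfl
    exact hab (right_mem_openSegment_iff.1 hz)

/-- Near an interior point of an edge, the drawing consists of that edge. -/
lemma exists_ball_inter_drawing [Finite V] {a b : V} (hab : G.Adj a b) {z : ℝ × ℝ}
    (hz : z ∈ openSegment ℝ (E.pos a) (E.pos b)) :
    ∃ r > 0, ∀ y ∈ Metric.ball z r, y ∈ E.drawing → y ∈ seg (E.pos a) (E.pos b) := by
  set D := E.part (fun _ => True) (fun c d => G.Adj c d ∧ s(c, d) ≠ s(a, b))
  have hD : IsClosed D := E.isClosed_part _ _
  have hzs : z ∈ seg (E.pos a) (E.pos b) := openSegment_subset_segment _ _ _ hz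
  have hzn := ne_of_mem_openSegment (fun h => hab.ne (E.inj h)) hz
  have hvD : z ∉ D := by
    rintro (⟨u, -, rfl⟩ | ⟨c, d, ⟨hcd, hne⟩, hz'⟩)
    · exact E.vertex_off hab (fun h => hzn.1 (h ▸ rfl)) (fun h => hzn.2 (h ▸ rfl)) hzs
    · rcases (eq_of_mem_seg_of_mem_seg hcd hab hne hz' hzs).2 with h | h
      · exact hzn.1 h
      · exact hzn.2 h
  obtain ⟨r, hr, hball⟩ := Metric.isOpen_iff.1 hD.isOpen_compl _ hvD
  refine ⟨r, hr, fun y hy hyD => ?_⟩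
  have hyD' := hball hy
  rcases E.mem_drawing_iff.1 hyD with ⟨u, rfl⟩ | ⟨c, d, hcd, hz'⟩
  · exact absurd (Or.inl ⟨u, trivial, rfl⟩) hyD'
  · by_cases hne : s(c, d) = s(a, b)
    · rcases Sym2.eq_iff.1 hne with ⟨rfl, rfl⟩ | ⟨rfl, rfl⟩
      · exact hz'
      · rwa [seg_comm]
    · exact absurd (Or.inr ⟨c, d, ⟨hcd, hne⟩, hz'⟩) hyD'

/-- If an interior point of an edge is on the boundary of a face, then so is the whole edge. -/
lemma seg_subset_closure_of_mem [Finite V] {F : Set (ℝ × ℝ)} (hF : E.IsFace F) {a b : V}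
    (hab : G.Adj a b) {z : ℝ × ℝ} (hz : z ∈ openSegment ℝ (E.pos a) (E.pos b))
    (hzF : z ∈ closure F) : seg (E.pos a) (E.pos b) ⊆ closure F := by
  set A := E.pos a
  set B := E.pos b
  have hAB : A ≠ B := fun h => hab.ne (E.inj h)
  let l : ℝ × ℝ → ℝ := fun y => (B.1 - A.1) * (y.2 - A.2) - (B.2 - A.2) * (y.1 - A.1)
  have hl0 : ∀ y ∈ seg A B, l y = 0 := by
    rintro y ⟨p, q, _, _, hpq, rfl⟩
    have : p = 1 - q := by linarith
    subst this
    simp [l]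
    ring
  have hlline : ∀ (y z : ℝ × ℝ) (t : ℝ),
      l (AffineMap.lineMap y z t) = (1 - t) * l y + t * l z := by
    intro y z t
    simp [l, AffineMap.lineMap_apply]
    ring
  have hlocal : ∀ z ∈ openSegment ℝ A B, z ∈ closure F →
      ∃ r > 0, ∀ z' ∈ Metric.ball z r ∩ seg A B, z' ∈ closure F := by
    intro z hz hzF
    obtain ⟨r, hr, hball⟩ := exists_ball_inter_drawing hab hz
    refine ⟨r, hr, ?_⟩
    rintro z' ⟨hz'b, hz's⟩
    have hopen : IsOpen (F ∩ Metric.ball z r) := (isFace_isOpen hF).inter Metric.isOpen_ball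
    obtain ⟨y, hyF, hyl⟩ : ∃ y ∈ F ∩ Metric.ball z r, l y ≠ 0 := by
      obtain ⟨y, hyF, hyd⟩ := Metric.mem_closure_iff.1 hzF r hr
      have hy : y ∈ F ∩ Metric.ball z r := ⟨hyF, by rwa [Metric.mem_ball, dist_comm]⟩
      by_cases hl : l y = 0
      · let n : ℝ × ℝ := (-(B.2 - A.2), B.1 - A.1)
        have hc : Continuous fun t : ℝ => y + t • n := by fun_prop
        have hev : ∀ᶠ t in nhds (0 : ℝ), y + t • n ∈ F ∩ Metric.ball z r := by
          refine hc.continuousAt.eventually_mem ?_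
          simpa using hopen.mem_nhds hy
        obtain ⟨t, ht, ht0⟩ := ((hev.filter_mono nhdsWithin_le_nhds).and
          (self_mem_nhdsWithin : Ioi (0 : ℝ) ∈ nhdsWithin 0 (Ioi 0))).exists
        have ht0 : 0 < t := ht0
        refine ⟨_, ht, ?_⟩
        have hcalc : l (y + t • n) = l y + t * ((B.1 - A.1) ^ 2 + (B.2 - A.2) ^ 2) := by
          simp [l, n]
          ring
        rw [hcalc, hl, zero_add]
        have hpos : 0 < (B.1 - A.1) ^ 2 + (B.2 - A.2) ^ 2 := by
          by_contra! hle
          have h1 : B.1 - A.1 = 0 := by nlinarith [sq_nonneg (B.1 - A.1), sq_nonneg (B.2 - A.2)]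
          have h2 : B.2 - A.2 = 0 := by nlinarith [sq_nonneg (B.1 - A.1), sq_nonneg (B.2 - A.2)]
          exact hAB (Prod.ext (by linarith) (by linarith))
        positivity
      · exact ⟨y, hy, hl⟩
    have hsub : (fun t : ℝ => (AffineMap.lineMap y z' t : ℝ × ℝ)) '' Ico 0 1 ⊆ F := by
      refine isFace_subset hF
        (isPreconnected_Ico.image _ (continuous_lineMap_plane y z').continuousOn) ?_
        ⟨y, ⟨0, by simp, by simp⟩, hyF.1⟩
      rintro _ ⟨t, ht, rfl⟩ hD
      have hmem : (AffineMap.lineMap y z' t : ℝ × ℝ) ∈ Metric.ball z r :=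
        (convex_ball z r).segment_subset hyF.2 hz'b (lineMap_mem_seg ht.1 ht.2.le)
      have := hl0 _ (hball _ hmem hD)
      rw [hlline, hl0 _ hz's, mul_zero, add_zero] at this
      rcases mul_eq_zero.1 this with h | h
      · linarith [ht.2]
      · exact hyl h
    have h1 : z' = AffineMap.lineMap y z' (1 : ℝ) := by simp
    rw [h1]
    refine closure_mono hsub ?_
    refine image_closure_subset_closure_image (continuous_lineMap_plane y z') ⟨1, ?_, rfl⟩
    rw [closure_Ico (by norm_num)]
    simp
  have hopen : openSegment ℝ A B ⊆ closure F := by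
    have hpre : IsPreconnected (openSegment ℝ A B) := (convex_openSegment A B).isPreconnected
    let W : Set (ℝ × ℝ) := {w | ∃ z ∈ openSegment ℝ A B, z ∈ closure F ∧
      ∃ r > 0, w ∈ Metric.ball z r ∧ ∀ z' ∈ Metric.ball z r ∩ seg A B, z' ∈ closure F}
    have hW : IsOpen W := by
      rw [isOpen_iff_mem_nhds]
      rintro w ⟨z, hz, hzF, r, hr, hw, h⟩
      filter_upwards [Metric.isOpen_ball.mem_nhds hw] with y hy
      exact ⟨z, hz, hzF, r, hr, hy, h⟩
    have hWF : ∀ w ∈ W, w ∈ openSegment ℝ A B → w ∈ closure F := by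
      rintro w ⟨z, hz, hzF, r, hr, hw, h⟩ hwo
      exact h w ⟨hw, openSegment_subset_segment _ _ _ hwo⟩
    have hcase := isPreconnected_iff_subset_of_disjoint.1 hpre W (closure F)ᶜ hW
      isClosed_closure.isOpen_compl ?_ ?_
    · rcases hcase with h | h
      · exact fun w hw => hWF w (h hw) hw
      · exact absurd hzF (h hz)
    · intro w hw
      by_cases hwF : w ∈ closure F
      · obtain ⟨r, hr, h⟩ := hlocal w hw hwF
        exact Or.inl ⟨w, hw, hwF, r, hr, Metric.mem_ball_self hr, h⟩
      · exact Or.inr hwF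
    · ext w
      simp only [mem_inter_iff, mem_compl_iff, mem_empty_iff_false, iff_false]
      rintro ⟨hw, hwW, hwF⟩
      exact hwF (hWF w hwW hw)
  calc seg A B ⊆ closure (openSegment ℝ A B) := segment_subset_closure_openSegment
    _ ⊆ closure F := closure_minimal hopen isClosed_closure

end PlaneEmb

lemma mem_seg_ray (p y : ℝ × ℝ) {t : ℝ} (ht : 0 ≤ t) : y ∈ seg p (y + t • (y - p)) := by
  refine ⟨t / (1 + t), 1 / (1 + t), by positivity, by positivity, by field_simp; ring, ?_⟩
  apply Prod.ext
  · simp only [Prod.fst_add, Prod.smul_fst, Prod.fst_sub, smul_eq_mul]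
    field_simp
    ring
  · simp only [Prod.snd_add, Prod.smul_snd, Prod.snd_sub, smul_eq_mul]
    field_simp
    ring

lemma mem_seg_of_ray {p x y : ℝ × ℝ} {t : ℝ} (ht : 0 ≤ t) (h : y + t • (y - p) ∈ seg p x) :
    y ∈ seg p x :=
  (convex_segment p x).segment_subset (left_mem_segment ℝ p x) h (mem_seg_ray p y ht)

/-- In a nondegenerate triangle, a ray from a vertex leaves the triangle at the opposite side. -/
lemma ray_notMem_seg {a b c : ℝ × ℝ} (hb : b ∉ seg a c) (ha : a ∉ seg b c) (hc : c ∉ seg b a)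
    {t : ℝ} (ht : 0 < t) :
    (AffineMap.lineMap a c (1 / 2 : ℝ) : ℝ × ℝ) +
      t • ((AffineMap.lineMap a c (1 / 2 : ℝ) : ℝ × ℝ) - b) ∉ seg a c := by
  rintro ⟨p, l, hp, hl, hpl, he⟩
  have hp' : p = 1 - l := by linarith
  subst hp'
  set k : ℝ := 1 / 2 - (l - 1 / 2) / t with hk
  have hbx : b.1 = a.1 + k * (c.1 - a.1) := by
    have h1 := congrArg Prod.fst he
    simp [AffineMap.lineMap_apply] at h1
    rw [hk]
    field_simp
    linarith
  have hby : b.2 = a.2 + k * (c.2 - a.2) := by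
    have h1 := congrArg Prod.snd he
    simp [AffineMap.lineMap_apply] at h1
    rw [hk]
    field_simp
    linarith
  rcases lt_or_ge k 0 with h0 | h0
  · have h1 : 0 < 1 - k := by linarith
    refine ha ⟨1 / (1 - k), -k / (1 - k), by positivity, div_nonneg (by linarith) h1.le,
      by field_simp; ring, ?_⟩
    apply Prod.ext
    · simp only [Prod.fst_add, Prod.smul_fst, smul_eq_mul, hbx]
      field_simp
      ring
    · simp only [Prod.snd_add, Prod.smul_snd, smul_eq_mul, hby]
      field_simp
      ring
  · rcases le_or_gt k 1 with h1 | h1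
    · refine hb ⟨1 - k, k, by linarith, h0, by ring, ?_⟩
      apply Prod.ext
      · simp only [Prod.fst_add, Prod.smul_fst, smul_eq_mul, hbx]
        ring
      · simp only [Prod.snd_add, Prod.smul_snd, smul_eq_mul, hby]
        ring
    · have hk0 : 0 < k := by linarith
      refine hc ⟨1 / k, (k - 1) / k, by positivity, div_nonneg (by linarith) hk0.le,
        by field_simp; ring, ?_⟩
      apply Prod.ext
      · simp only [Prod.fst_add, Prod.smul_fst, smul_eq_mul, hbx]
        field_simp
        ring
      · simp only [Prod.snd_add, Prod.smul_snd, smul_eq_mul, hby]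
        field_simp
        ring

lemma csqrt_ratio_jump {p q z : ℝ × ℝ} (hpq : p ≠ q) (hz : z ∈ openSegment ℝ p q)
    {f k : ℝ × ℝ → ℂ} (hf : ContinuousAt f z) (hk : ContinuousAt k z) (hk0 : ∀ y, k y ≠ 0)
    {δ : ℂ} (hδ : δ = 1 ∨ δ = -1)
    (h : ∀ᶠ y in nhds z, y ∉ seg p q → f y / (csqrt (ratio p q y) * k y) = δ) : False := by
  refine not_continuousAt_csqrt_ratio hpq hz (g := fun y => δ * (f y / k y))
    (continuousAt_const.mul (hf.div hk (hk0 z))) ?_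
  filter_upwards [h] with y hy hys
  have h1 := hy hys
  have h2 := csqrt_ne_zero (ratio p q y)
  have h3 := hk0 y
  have hδ2 : δ * δ = 1 := by rcases hδ with rfl | rfl <;> norm_num
  rw [div_eq_iff (mul_ne_zero h2 h3)] at h1
  rw [h1, ← mul_assoc, mul_div_cancel_right₀ _ h3, ← mul_assoc, hδ2, one_mul]

/-- Two segments `p₀ p₁` and `p₁ p₂` whose ends see the connected open set `F` split the
complement of `F` into two sides, both of which are adherent to the interior of either segment. -/
lemma exists_side_fun {F : Set (ℝ × ℝ)} (hF : IsOpen F) (hc : IsPreconnected F)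
    {a b p₀ p₁ p₂ : ℝ × ℝ} (ha : a ∈ F) (hb : b ∈ F) (haa : seg p₀ a \ {p₀} ⊆ F)
    (hbb : seg p₂ b \ {p₂} ⊆ F) (h01 : p₀ ≠ p₁) (h12 : p₁ ≠ p₂)
    (hd01 : ∀ z ∈ openSegment ℝ p₀ p₁, z ∉ closure F ∧ z ∉ seg p₁ p₂)
    (hd12 : ∀ z ∈ openSegment ℝ p₁ p₂, z ∉ closure F ∧ z ∉ seg p₀ p₁) :
    ∃ τ : ℝ × ℝ → ℂ, ContinuousOn τ (Fᶜ \ (seg p₀ p₁ ∪ seg p₁ p₂)) ∧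
      (∀ z ∈ Fᶜ \ (seg p₀ p₁ ∪ seg p₁ p₂), τ z = 1 ∨ τ z = -1) ∧
      ∀ z, z ∈ openSegment ℝ p₀ p₁ ∨ z ∈ openSegment ℝ p₁ p₂ → ∀ ε : ℂ, ε = 1 ∨ ε = -1 →
        z ∈ closure {y | y ∈ Fᶜ \ (seg p₀ p₁ ∪ seg p₁ p₂) ∧ τ y = ε} := by
  obtain ⟨f, cf, ef⟩ := exists_sqrt_ratio_of_accessible hF hc ha hb haa hbb
  have hsub : Fᶜ \ (seg p₀ p₁ ∪ seg p₁ p₂) ⊆ Fᶜ \ {p₀, p₂} := by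
    refine sdiff_subset_sdiff_right ?_
    rintro z (rfl | rfl)
    · exact Or.inl (left_mem_seg _ _)
    · exact Or.inr (right_mem_seg _ _)
  have hval : ∀ z ∈ Fᶜ \ (seg p₀ p₁ ∪ seg p₁ p₂),
      f z / (csqrt (ratio p₀ p₁ z) * csqrt (ratio p₁ p₂ z)) = 1 ∨
      f z / (csqrt (ratio p₀ p₁ z) * csqrt (ratio p₁ p₂ z)) = -1 := by
    intro z hz
    have hz1 : z ∉ seg p₀ p₁ := fun h => hz.2 (Or.inl h)
    have hz2 : z ∉ seg p₁ p₂ := fun h => hz.2 (Or.inr h)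
    have hne : ratio p₀ p₂ z ≠ 0 := by
      refine ratio_ne_zero ?_ ?_
      · rintro rfl; exact hz1 (left_mem_seg _ _)
      · rintro rfl; exact hz2 (right_mem_seg _ _)
    rw [← sq_eq_one_iff, div_pow, mul_pow, csqrt_ratio_sq hz1, csqrt_ratio_sq hz2,
      ef z (hsub hz), ratio_mul, div_self hne]
    rintro rfl
    exact hz1 (right_mem_seg _ _)
  have hfat : ∀ z, z ∉ closure F → z ≠ p₀ → z ≠ p₂ → ContinuousAt f z := by
    intro z hz hz0 hz2
    refine cf.continuousAt ?_
    have h1 : (closure F)ᶜ ∈ nhds z := isClosed_closure.isOpen_compl.mem_nhds hz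
    have h2 : ({p₀, p₂} : Set (ℝ × ℝ))ᶜ ∈ nhds z :=
      (Set.toFinite _).isClosed.isOpen_compl.mem_nhds (by simp [hz0, hz2])
    filter_upwards [h1, h2] with y hy1 hy2
    exact ⟨fun h => hy1 (subset_closure h), hy2⟩
  refine ⟨fun z => f z / (csqrt (ratio p₀ p₁ z) * csqrt (ratio p₁ p₂ z)), ?_, hval, ?_⟩
  · intro z hz
    have hz1 : z ∉ seg p₀ p₁ := fun h => hz.2 (Or.inl h)
    have hz2 : z ∉ seg p₁ p₂ := fun h => hz.2 (Or.inr h)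
    refine ((cf.mono hsub) z hz).div (((continuousAt_csqrt_ratio hz1).mul
      (continuousAt_csqrt_ratio hz2)).continuousWithinAt) ?_
    exact mul_ne_zero (csqrt_ne_zero _) (csqrt_ne_zero _)
  · intro z hz ε hε
    by_contra hcl
    have e1 : ∀ᶠ y in nhds z, ¬ (y ∈ Fᶜ \ (seg p₀ p₁ ∪ seg p₁ p₂) ∧
        f y / (csqrt (ratio p₀ p₁ y) * csqrt (ratio p₁ p₂ y)) = ε) := by
      filter_upwards [isClosed_closure.isOpen_compl.mem_nhds hcl] with y hy h
      exact hy (subset_closure h)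
    have hδ : -ε = 1 ∨ -ε = -1 := by rcases hε with rfl | rfl <;> simp
    have e2 : ∀ y ∈ Fᶜ \ (seg p₀ p₁ ∪ seg p₁ p₂),
        f y / (csqrt (ratio p₀ p₁ y) * csqrt (ratio p₁ p₂ y)) ≠ ε →
        f y / (csqrt (ratio p₀ p₁ y) * csqrt (ratio p₁ p₂ y)) = -ε := by
      intro y hy hne
      rcases hval y hy with h | h <;> rcases hε with rfl | rfl
      · exact absurd h hne
      · rw [h, neg_neg]
      · exact h
      · exact absurd h hne
    rcases hz with hz | hz
    · obtain ⟨hzF, hzs⟩ := hd01 z hz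
      have hz0 := (PlaneEmb.ne_of_mem_openSegment h01 hz).1
      have hz2 : z ≠ p₂ := by rintro rfl; exact hzs (right_mem_seg _ _)
      refine csqrt_ratio_jump h01 hz (hfat z hzF hz0 hz2) (continuousAt_csqrt_ratio hzs)
        (fun _ => csqrt_ne_zero _) hδ ?_
      filter_upwards [e1, isClosed_closure.isOpen_compl.mem_nhds hzF,
        (isClosed_seg p₁ p₂).isOpen_compl.mem_nhds hzs] with y h1 h2 h3 h4
      have hy : y ∈ Fᶜ \ (seg p₀ p₁ ∪ seg p₁ p₂) :=
        ⟨fun h => h2 (subset_closure h), fun h => h.elim h4 h3⟩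
      exact e2 y hy fun h => h1 ⟨hy, h⟩
    · obtain ⟨hzF, hzs⟩ := hd12 z hz
      have hz2 := (PlaneEmb.ne_of_mem_openSegment h12 hz).2
      have hz0 : z ≠ p₀ := by rintro rfl; exact hzs (left_mem_seg _ _)
      refine csqrt_ratio_jump h12 hz (hfat z hzF hz0 hz2) (continuousAt_csqrt_ratio hzs)
        (fun _ => csqrt_ne_zero _) hδ ?_
      filter_upwards [e1, isClosed_closure.isOpen_compl.mem_nhds hzF,
        (isClosed_seg p₀ p₁).isOpen_compl.mem_nhds hzs] with y h1 h2 h3 h4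
      have hy : y ∈ Fᶜ \ (seg p₀ p₁ ∪ seg p₁ p₂) :=
        ⟨fun h => h2 (subset_closure h), fun h => h.elim h3 h4⟩
      rw [mul_comm]
      exact e2 y hy fun h => h1 ⟨hy, h⟩

/-- A continuous `±1`-valued function is constant on preconnected sets. -/
lemma eq_of_isPreconnected {X : Type*} [TopologicalSpace X] {τ : X → ℂ} {K S : Set X}
    (hτ : ContinuousOn τ K) (hv : ∀ z ∈ K, τ z = 1 ∨ τ z = -1) (hS : IsPreconnected S)
    (hSK : S ⊆ K) {x y : X} (hx : x ∈ S) (hy : y ∈ S) : τ x = τ y :=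
  hS.constant_of_mapsTo (T := {1, -1}) (Set.toFinite _).isDiscrete (hτ.mono hSK)
    (fun z hz => hv z (hSK hz)) hx hy

/-- A point whose side of the complement of `F` is blocked, along a ray, only by points
of the other side lies in the component containing `F`. -/
lemma mem_component_of_ray {F T D : Set (ℝ × ℝ)} {τ : ℝ × ℝ → ℂ} (hc : IsPreconnected F)
    (hFb : Bornology.IsBounded Fᶜ) (hτ : ContinuousOn τ (Fᶜ \ T))
    (hv : ∀ z ∈ Fᶜ \ T, τ z = 1 ∨ τ z = -1) (hD : IsClosed D) (hDF : D ⊆ Fᶜ) (hTD : T ⊆ D)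
    {p d q : ℝ × ℝ} (hq : q ∈ F) (hpD : p ∉ D) (hd : d ≠ 0)
    (h : ∀ t : ℝ, 0 ≤ t → p + t • d ∈ D → p + t • d ∉ T ∧ τ (p + t • d) ≠ τ p) :
    p ∈ connectedComponentIn Dᶜ q := by
  have hFD : F ⊆ Dᶜ := fun z hz hzD => hDF hzD hz
  set X := connectedComponentIn Dᶜ p with hX
  have hpX : p ∈ X := mem_connectedComponentIn hpD
  by_cases hXF : (F ∩ X).Nonempty
  · have : F ⊆ X := subset_connectedComponentIn_of_inter hc hFD hXF
    rw [← connectedComponentIn_eq (this hq)]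
    exact hpX
  · exfalso
    have hXF' : X ⊆ Fᶜ := fun z hz hzF => hXF ⟨z, hzF, hz⟩
    have hXD : X ⊆ Dᶜ := connectedComponentIn_subset _ _
    have hXK : X ⊆ Fᶜ \ T := fun z hz => ⟨hXF' hz, fun hzT => hXD hz (hTD hzT)⟩
    obtain ⟨t, ht, hcl, hnot⟩ := exists_frontier_on_ray hD.isOpen_compl hpD hd
      (hFb.subset hXF')
    obtain ⟨h1, h2⟩ := h t ht (not_not.1 hnot)
    have hpre : IsPreconnected (insert (p + t • d) X) :=
      isPreconnected_connectedComponentIn.subset_closure (subset_insert _ _)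
        (insert_subset hcl subset_closure)
    refine h2 (eq_of_isPreconnected hτ hv hpre ?_ (mem_insert _ _) (mem_insert_of_mem _ hpX))
    exact insert_subset ⟨hDF (not_not.1 hnot), h1⟩ hXK

/-- The previous lemma for the two-segment set `T`, which blocks no ray from its apex. -/
lemma mem_component_of_side {F D : Set (ℝ × ℝ)} {p₀ p₁ p₂ : ℝ × ℝ} {τ : ℝ × ℝ → ℂ}
    (hc : IsPreconnected F) (hFb : Bornology.IsBounded Fᶜ)
    (hτ : ContinuousOn τ (Fᶜ \ (seg p₀ p₁ ∪ seg p₁ p₂)))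
    (hv : ∀ z ∈ Fᶜ \ (seg p₀ p₁ ∪ seg p₁ p₂), τ z = 1 ∨ τ z = -1)
    (hD : IsClosed D) (hDF : D ⊆ Fᶜ) (hTD : seg p₀ p₁ ∪ seg p₁ p₂ ⊆ D) {ε : ℂ}
    (hside : ∀ y ∈ D, y ∉ seg p₀ p₁ ∪ seg p₁ p₂ → τ y ≠ ε) {p q : ℝ × ℝ} (hq : q ∈ F)
    (hp : p ∈ Fᶜ \ (seg p₀ p₁ ∪ seg p₁ p₂)) (hpε : τ p = ε) :
    p ∈ connectedComponentIn Dᶜ q := by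
  have hp1 : p ≠ p₁ := by
    rintro rfl
    exact hp.2 (Or.inl (right_mem_seg _ _))
  refine mem_component_of_ray hc hFb hτ hv hD hDF hTD hq
    (fun h => hside p h hp.2 hpε) (sub_ne_zero.2 hp1) ?_
  intro t ht hmem
  have hnT : p + t • (p - p₁) ∉ seg p₀ p₁ ∪ seg p₁ p₂ := by
    rintro (h | h)
    · rw [seg_comm] at h
      exact hp.2 (Or.inl (seg_comm p₁ p₀ ▸ mem_seg_of_ray ht h))
    · exact hp.2 (Or.inr (mem_seg_of_ray ht h))
  exact ⟨hnT, hpε ▸ hside _ hmem hnT⟩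

namespace PlaneEmb

variable {E : PlaneEmb G}

lemma drawing_subset_compl {F : Set (ℝ × ℝ)} (hF : E.IsFace F) : E.drawing ⊆ Fᶜ :=
  fun _ hz hzF => isFace_disjoint hF hzF hz

lemma part_subset_drawing {S : V → Prop} {R : V → V → Prop} (hR : ∀ a b, R a b → G.Adj a b) :
    E.part S R ⊆ E.drawing := by
  rintro z (⟨v, -, rfl⟩ | ⟨a, b, hab, hz⟩)
  · exact E.pos_mem_drawing v
  · exact E.seg_subset_drawing (hR a b hab) hz

/-- An edge with an end off the boundary of a face has no interior point on that boundary, and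
no interior point on another edge. -/
lemma notMem_of_mem_openSegment [Finite V] {F : Set (ℝ × ℝ)} (hF : E.IsFace F) {a b : V}
    (hab : G.Adj a b) (h : ¬ E.BoundaryEdge F a b) {z : ℝ × ℝ}
    (hz : z ∈ openSegment ℝ (E.pos a) (E.pos b)) :
    z ∉ closure F ∧ ∀ c d, G.Adj c d → s(a, b) ≠ s(c, d) → z ∉ seg (E.pos c) (E.pos d) := by
  refine ⟨fun hzF => h ⟨hab, seg_subset_closure_of_mem hF hab hz hzF⟩, ?_⟩
  intro c d hcd hne hz'
  have hn := ne_of_mem_openSegment (fun he => hab.ne (E.inj he)) hz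
  rcases (eq_of_mem_seg_of_mem_seg hab hcd hne (openSegment_subset_segment _ _ _ hz) hz').1
    with h | h
  · exact hn.1 h
  · exact hn.2 h

/-- A separating 2-chord of the outer face splits the remaining vertices into two nonempty sides
with no edge between them, and stays on the boundary of the outer face when one side is erased
together with the possible edge joining the ends. -/
theorem exists_sides [Finite V] {F : Set (ℝ × ℝ)} (hF : E.IsOuterFace F) {v0 v1 v2 : V}
    (h01 : G.Adj v0 v1) (h12 : G.Adj v1 v2) (hne : v0 ≠ v2) (hv0 : v0 ∈ E.onFace F)
    (hv2 : v2 ∈ E.onFace F) (hv1 : v1 ∉ E.onFace F) (hb : ¬ E.BoundaryEdge F v0 v2) :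
    ∃ σ : V → Bool,
      (∀ u v, G.Adj u v → u ∉ ({v0, v1, v2} : Set V) → v ∉ ({v0, v1, v2} : Set V) → σ u = σ v) ∧
      (∀ s, ∃ v, v ∉ ({v0, v1, v2} : Set V) ∧ σ v = s) ∧
      ∀ s D', IsClosed D' → seg (E.pos v0) (E.pos v1) ∪ seg (E.pos v1) (E.pos v2) ⊆ D' →
        D' ⊆ E.part (fun u => u ∈ ({v0, v1, v2} : Set V) ∨ σ u = s)
          (fun a b => G.Adj a b ∧ (a ∈ ({v0, v1, v2} : Set V) ∨ σ a = s) ∧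
            (b ∈ ({v0, v1, v2} : Set V) ∨ σ b = s) ∧ s(a, b) ≠ s(v0, v2)) →
        ∀ q ∈ F, seg (E.pos v0) (E.pos v1) ∪ seg (E.pos v1) (E.pos v2) ⊆
          closure (connectedComponentIn D'ᶜ q) := by
  have hFo : IsOpen F := isFace_isOpen hF.1
  have hFc : IsPreconnected F := by
    obtain ⟨⟨q, _, rfl⟩, -⟩ := hF
    exact isPreconnected_connectedComponentIn
  have hFb : Bornology.IsBounded Fᶜ := by
    obtain ⟨⟨q, _, rfl⟩, h⟩ := hF
    exact isBounded_compl_component E.isCompact_drawing.isBounded h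
  have hDF : E.drawing ⊆ Fᶜ := drawing_subset_compl hF.1
  have hmF : ∀ {q}, q ∈ F → ∀ z, z ∈ Fᶜ → z ∉ connectedComponentIn E.drawingᶜ q := by
    intro q hq z hz h
    obtain ⟨⟨q', _, rfl⟩, -⟩ := hF
    exact hz (connectedComponentIn_eq hq ▸ h)
  obtain ⟨a, ha, haa⟩ := exists_accessible hF.1 hv0
  obtain ⟨b, hbF, hbb⟩ := exists_accessible hF.1 hv2
  have hp01 : E.pos v0 ≠ E.pos v1 := fun h => h01.ne (E.inj h)
  have hp12 : E.pos v1 ≠ E.pos v2 := fun h => h12.ne (E.inj h)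
  have hs : s(v0, v1) ≠ s(v1, v2) := by
    intro h
    rcases Sym2.eq_iff.1 h with ⟨h, -⟩ | ⟨h, -⟩
    · exact h01.ne h
    · exact hne h
  have hn01 : ¬ E.BoundaryEdge F v0 v1 := fun h => hv1 (h.2 (right_mem_seg _ _))
  have hn12 : ¬ E.BoundaryEdge F v1 v2 := fun h => hv1 (h.2 (left_mem_seg _ _))
  obtain ⟨τ, hτ, hval, hcl⟩ := exists_side_fun hFo hFc ha hbF haa hbb hp01 hp12
    (fun z hz => ⟨(notMem_of_mem_openSegment hF.1 h01 hn01 hz).1,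
      (notMem_of_mem_openSegment hF.1 h01 hn01 hz).2 _ _ h12 hs⟩)
    (fun z hz => ⟨(notMem_of_mem_openSegment hF.1 h12 hn12 hz).1,
      (notMem_of_mem_openSegment hF.1 h12 hn12 hz).2 _ _ h01 hs.symm⟩)
  set T := seg (E.pos v0) (E.pos v1) ∪ seg (E.pos v1) (E.pos v2) with hT
  set Q : Set V := {v0, v1, v2} with hQ
  have hTD : T ⊆ E.drawing :=
    union_subset (E.seg_subset_drawing h01) (E.seg_subset_drawing h12)
  have hposT : ∀ u ∉ Q, E.pos u ∉ T := by
    intro u hu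
    simp only [hQ, mem_insert_iff, mem_singleton_iff, not_or] at hu
    rintro (h | h)
    · exact E.vertex_off h01 hu.1 hu.2.1 h
    · exact E.vertex_off h12 hu.2.1 hu.2.2 h
  have hQT : ∀ u ∈ Q, E.pos u ∈ T := by
    rintro u (rfl | rfl | rfl)
    · exact Or.inl (left_mem_seg _ _)
    · exact Or.inl (right_mem_seg _ _)
    · exact Or.inr (right_mem_seg _ _)
  have hedge : ∀ {u v}, G.Adj u v → u ∉ Q → ∀ z ∈ seg (E.pos u) (E.pos v), z ∉ T →
      τ z = τ (E.pos u) := by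
    intro u v huv hu z hz hzT
    have key : ∀ y ∈ seg (E.pos u) (E.pos v), y ∈ T → y = E.pos v := by
      have hu' := hposT u hu
      intro y hy hyT
      have hyu : y ≠ E.pos u := fun h => hu' (h ▸ hyT)
      have hu0 : u ≠ v0 ∧ u ≠ v1 ∧ u ≠ v2 := by simpa [hQ] using hu
      rcases hyT with h | h
      · refine ((eq_of_mem_seg_of_mem_seg huv h01 ?_ hy h).1).resolve_left hyu
        intro he
        rcases Sym2.eq_iff.1 he with ⟨h, -⟩ | ⟨h, -⟩
        · exact hu0.1 h
        · exact hu0.2.1 h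
      · refine ((eq_of_mem_seg_of_mem_seg huv h12 ?_ hy h).1).resolve_left hyu
        intro he
        rcases Sym2.eq_iff.1 he with ⟨h, -⟩ | ⟨h, -⟩
        · exact hu0.2.1 h
        · exact hu0.2.2 h
    have hsegD := E.seg_subset_drawing huv
    by_cases hv : v ∈ Q
    · refine eq_of_isPreconnected hτ hval (isPreconnected_seg_diff_left (E.pos v) (E.pos u)
        (fun h => huv.ne (E.inj h.symm))) ?_ ⟨seg_comm _ _ ▸ hz, ?_⟩ ⟨right_mem_seg _ _, ?_⟩
      · rintro y ⟨hy, hyv⟩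
        rw [seg_comm] at hy
        exact ⟨hDF (hsegD hy), fun h => hyv (key y hy h)⟩
      · rintro rfl
        exact hzT (hQT v hv)
      · exact fun h => huv.ne (E.inj h)
    · refine eq_of_isPreconnected hτ hval (convex_segment (E.pos u) (E.pos v)).isPreconnected
        ?_ hz (left_mem_seg _ _)
      exact fun y hy => ⟨hDF (hsegD hy), fun h => hposT v hv (key y hy h ▸ h)⟩
  let sgn : Bool → ℂ := fun s => if s then 1 else -1
  have hsgn : ∀ s, sgn s = 1 ∨ sgn s = -1 := by
    rintro (_ | _) <;> simp [sgn]
  have hsgn_inj : ∀ {s t}, sgn s = sgn t → s = t := by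
    rintro (_ | _) (_ | _) <;> norm_num [sgn]
  classical
  let σ : V → Bool := fun v => decide (τ (E.pos v) = 1)
  have hσ : ∀ v ∉ Q, τ (E.pos v) = sgn (σ v) := by
    intro v hv
    rcases hval _ ⟨hDF (E.pos_mem_drawing v), hposT v hv⟩ with h | h <;>
      norm_num [σ, sgn, h]
  have hQcases : ∀ {u v}, G.Adj u v → u ∈ Q → v ∈ Q →
      s(u, v) = s(v0, v2) ∨ seg (E.pos u) (E.pos v) ⊆ T := by
    rintro u v huv (rfl | rfl | rfl) (rfl | rfl | rfl)
    · exact absurd rfl huv.ne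
    · exact Or.inr subset_union_left
    · exact Or.inl rfl
    · exact Or.inr (seg_comm (E.pos u) (E.pos v) ▸ subset_union_left)
    · exact absurd rfl huv.ne
    · exact Or.inr subset_union_right
    · exact Or.inl Sym2.eq_swap
    · exact Or.inr (seg_comm (E.pos u) (E.pos v) ▸ subset_union_right)
    · exact absurd rfl huv.ne
  have hpartside : ∀ {s} {S : V → Prop} {R : V → V → Prop},
      (∀ u, S u → u ∉ Q → σ u = s) →
      (∀ a b, R a b → G.Adj a b ∧ (a ∉ Q → σ a = s) ∧ (b ∉ Q → σ b = s)) →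
      ∀ y ∈ E.part S R, y ∉ T → τ y = sgn s ∨
        ∃ a b, R a b ∧ s(a, b) = s(v0, v2) ∧ y ∈ seg (E.pos a) (E.pos b) := by
    rintro s S R hS hR y (⟨u, hu, rfl⟩ | ⟨a, b, hab, hy⟩) hyT
    · have huQ : u ∉ Q := fun h => hyT (hQT u h)
      left
      rw [hσ u huQ, hS u hu huQ]
    · obtain ⟨hadj, ha, hb⟩ := hR a b hab
      by_cases haQ : a ∈ Q
      · by_cases hbQ : b ∈ Q
        · rcases hQcases hadj haQ hbQ with h | h
          · exact Or.inr ⟨a, b, hab, h, hy⟩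
          · exact absurd (h hy) hyT
        · left
          rw [hedge hadj.symm hbQ y (seg_comm _ _ ▸ hy) hyT, hσ b hbQ, hb hbQ]
      · left
        rw [hedge hadj haQ y hy hyT, hσ a haQ, ha haQ]
  refine ⟨σ, ?_, ?_, ?_⟩
  · intro u v huv hu hv
    apply hsgn_inj
    rw [← hσ u hu, ← hσ v hv]
    exact (hedge huv hu _ (right_mem_seg _ _) (hposT v hv)).symm
  · intro s
    by_contra! hcon
    have hside : ∀ y ∈ E.drawing, y ∉ T → τ y ≠ sgn s ∨
        G.Adj v0 v2 ∧ y ∈ seg (E.pos v0) (E.pos v2) := by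
      intro y hy hyT
      have hy' : y ∈ E.part (fun _ => True) G.Adj := by
        rcases E.mem_drawing_iff.1 hy with ⟨v, h⟩ | h
        · exact Or.inl ⟨v, trivial, h⟩
        · exact Or.inr h
      have hnot : ∀ u, u ∉ Q → σ u = !s := fun u hu => by
        simpa using Bool.eq_not_of_ne (hcon u hu)
      rcases hpartside (s := !s) (fun u _ hu => hnot u hu)
        (fun a b hab => ⟨hab, hnot a, hnot b⟩) y hy' hyT with h | ⟨a, b, hab, he, hz⟩
      · left
        rw [h]
        intro h'
        have := hsgn_inj h'
        simp at this
      · right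
        rcases Sym2.eq_iff.1 he with ⟨rfl, rfl⟩ | ⟨rfl, rfl⟩
        · exact ⟨hab, hz⟩
        · exact ⟨hab.symm, seg_comm _ _ ▸ hz⟩
    set m : ℝ × ℝ := AffineMap.lineMap (E.pos v0) (E.pos v2) (1 / 2 : ℝ)
    have hmo : m ∈ openSegment ℝ (E.pos v0) (E.pos v2) :=
      lineMap_mem_openSegment (by norm_num) (by norm_num)
    by_cases hcase : G.Adj v0 v2 ∧ τ m = sgn s
    · obtain ⟨h02, hmτ⟩ := hcase
      have hs1 : s(v0, v2) ≠ s(v0, v1) := by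
        intro h
        rcases Sym2.eq_iff.1 h with ⟨-, h⟩ | ⟨h, -⟩
        · exact h12.ne h.symm
        · exact h01.ne h
      have hs2 : s(v0, v2) ≠ s(v1, v2) := by
        intro h
        rcases Sym2.eq_iff.1 h with ⟨h, -⟩ | ⟨h, -⟩
        · exact h01.ne h
        · exact hne h
      obtain ⟨hmF', hmd⟩ := notMem_of_mem_openSegment hF.1 h02 hb hmo
      have hmT : m ∉ T := by
        rintro (h | h)
        · exact hmd _ _ h01 hs1 h
        · exact hmd _ _ h12 hs2 h
      have hTc : IsClosed T := (isClosed_seg _ _).union (isClosed_seg _ _)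
      have hKn : Fᶜ \ T ∈ nhds m := by
        filter_upwards [isClosed_closure.isOpen_compl.mem_nhds hmF',
          hTc.isOpen_compl.mem_nhds hmT] with y h1 h2
        exact ⟨fun h => h1 (subset_closure h), h2⟩
      have hev : ∀ᶠ y in nhds m, y ∈ Fᶜ \ T ∧ τ y = sgn s := by
        have h1 : ∀ᶠ y in nhds m, dist (τ y) (τ m) < 1 :=
          (hτ.continuousAt hKn).eventually (Metric.ball_mem_nhds _ one_pos)
        filter_upwards [hKn, h1] with y hy hyd
        refine ⟨hy, ?_⟩
        rw [hmτ] at hyd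
        rcases hval y hy with h | h <;> rcases hsgn s with h' | h' <;> rw [h, h'] at hyd ⊢ <;>
          norm_num [dist_eq_norm] at hyd
      set d := m - E.pos v1 with hd
      have hd0 : d ≠ 0 := by
        refine sub_ne_zero.2 fun h => hmT ?_
        rw [h]
        exact Or.inl (right_mem_seg _ _)
      have hcont : Continuous fun t : ℝ => m + t • d := by fun_prop
      have hev' : ∀ᶠ t in nhds (0 : ℝ), m + t • d ∈ Fᶜ \ T ∧ τ (m + t • d) = sgn s := by
        have : Filter.Tendsto (fun t : ℝ => m + t • d) (nhds 0) (nhds m) := by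
          simpa using hcont.tendsto 0
        exact this.eventually hev
      obtain ⟨t0, ⟨hp, hpτ⟩, ht0⟩ := ((hev'.filter_mono nhdsWithin_le_nhds).and
        (self_mem_nhdsWithin : Ioi (0 : ℝ) ∈ nhdsWithin 0 (Ioi 0))).exists
      have ht0 : 0 < t0 := ht0
      have hray : ∀ t : ℝ, 0 < t → m + t • d ∈ E.drawing →
          m + t • d ∉ T ∧ τ (m + t • d) ≠ sgn s := by
        intro t ht hmem
        have hnT : m + t • d ∉ T := by
          rintro (h | h)
          · rw [seg_comm] at h
            exact hmT (Or.inl (seg_comm (E.pos v1) (E.pos v0) ▸ mem_seg_of_ray ht.le h))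
          · exact hmT (Or.inr (mem_seg_of_ray ht.le h))
        refine ⟨hnT, ?_⟩
        rcases hside _ hmem hnT with h | ⟨-, h⟩
        · exact h
        · exact absurd h (ray_notMem_seg (E.vertex_off h02 h01.ne' h12.ne)
            (E.vertex_off h12 h01.ne hne) (seg_comm (E.pos v0) (E.pos v1) ▸
              E.vertex_off h01 hne.symm h12.ne') ht)
      refine hmF ha _ hp.1 (mem_component_of_ray hFc hFb hτ hval E.isCompact_drawing.isClosed
        hDF hTD ha (fun h => (hray t0 ht0 h).2 hpτ) hd0 ?_)
      intro t ht hmem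
      rw [add_assoc, ← add_smul] at hmem ⊢
      rw [hpτ]
      exact hray _ (by linarith) hmem
    · have hside' : ∀ y ∈ E.drawing, y ∉ T → τ y ≠ sgn s := by
        intro y hy hyT
        rcases hside y hy hyT with h | ⟨h02, hys⟩
        · exact h
        · have hs1 : s(v0, v2) ≠ s(v0, v1) := by
            intro h
            rcases Sym2.eq_iff.1 h with ⟨-, h⟩ | ⟨h, -⟩
            · exact h12.ne h.symm
            · exact h01.ne h
          have hs2 : s(v0, v2) ≠ s(v1, v2) := by
            intro h
            rcases Sym2.eq_iff.1 h with ⟨h, -⟩ | ⟨h, -⟩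
            · exact h01.ne h
            · exact hne h
          have hyo : y ∈ openSegment ℝ (E.pos v0) (E.pos v2) := by
            refine mem_openSegment_of_ne_left_right ?_ ?_ hys
            · rintro h
              exact hyT (h ▸ hQT v0 (Or.inl rfl))
            · rintro h
              exact hyT (h ▸ hQT v2 (Or.inr (Or.inr rfl)))
          have : τ y = τ m := by
            refine eq_of_isPreconnected hτ hval
              (convex_openSegment (E.pos v0) (E.pos v2)).isPreconnected ?_ hyo hmo
            intro z hz
            obtain ⟨-, h2⟩ := notMem_of_mem_openSegment hF.1 h02 hb hz
            refine ⟨hDF (E.seg_subset_drawing h02 (openSegment_subset_segment _ _ _ hz)), ?_⟩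
            rintro (h | h)
            · exact h2 _ _ h01 hs1 h
            · exact h2 _ _ h12 hs2 h
          rw [this]
          exact fun h => hcase ⟨h02, h⟩
      have hmid : (AffineMap.lineMap (E.pos v0) (E.pos v1) (1 / 2 : ℝ) : ℝ × ℝ) ∈
          openSegment ℝ (E.pos v0) (E.pos v1) :=
        lineMap_mem_openSegment (by norm_num) (by norm_num)
      obtain ⟨p, hp, hpτ⟩ := closure_nonempty_iff.1 ⟨_, hcl _ (Or.inl hmid) (sgn s) (hsgn s)⟩
      exact hmF ha _ hp.1 (mem_component_of_side hFc hFb hτ hval E.isCompact_drawing.isClosed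
        hDF hTD hside' ha hp hpτ)
  · intro s D' hD' hTD' hDp q hq
    have hD'D : D' ⊆ E.drawing := hDp.trans (part_subset_drawing fun a b h => h.1)
    have hside : ∀ y ∈ D', y ∉ T → τ y ≠ sgn (!s) := by
      intro y hy hyT
      rcases hpartside (s := s) (fun u h hu => h.resolve_left hu)
        (fun a b h => ⟨h.1, h.2.1.resolve_left, h.2.2.1.resolve_left⟩) y (hDp hy) hyT
        with h | ⟨a, b, h, he, -⟩
      · rw [h]
        intro h'
        have := hsgn_inj h'
        simp at this
      · exact absurd he h.2.2.2
    have hsub : {y | y ∈ Fᶜ \ T ∧ τ y = sgn (!s)} ⊆ connectedComponentIn D'ᶜ q :=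
      fun y hy => mem_component_of_side hFc hFb hτ hval hD' (hD'D.trans hDF) hTD' hside hq
        hy.1 hy.2
    have hopen : ∀ z, z ∈ openSegment ℝ (E.pos v0) (E.pos v1) ∨
        z ∈ openSegment ℝ (E.pos v1) (E.pos v2) → z ∈ closure (connectedComponentIn D'ᶜ q) :=
      fun z hz => closure_mono hsub (hcl z hz _ (hsgn _))
    refine union_subset ?_ ?_
    · exact segment_subset_closure_openSegment.trans
        (closure_minimal (fun z hz => hopen z (Or.inl hz)) isClosed_closure)
    · exact segment_subset_closure_openSegment.trans
        (closure_minimal (fun z hz => hopen z (Or.inr hz)) isClosed_closure)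

end PlaneEmb

namespace PlaneEmb

/-- The embedding induced on a graph mapping injectively into an embedded graph. -/
def restrict (E : PlaneEmb G) {W : Type} {H : SimpleGraph W} (f : H →g G)
    (hf : Function.Injective f) : PlaneEmb H where
  pos := E.pos ∘ f
  inj := E.inj.comp hf
  edges_meet a b c d hab hcd hne := by
    refine E.edges_meet (f.map_adj hab) (f.map_adj hcd) fun h => hne ?_
    exact Sym2.map.injective hf (by simpa using h)
  vertex_off a b v hab ha hb := E.vertex_off (f.map_adj hab) (hf.ne ha) (hf.ne hb)

end PlaneEmb

lemma HasCycleLen.map {W : Type} {H : SimpleGraph W} {n : ℕ} (h : HasCycleLen H n) (f : H →g G)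
    (hf : Function.Injective f) : HasCycleLen G n := by
  obtain ⟨v, c, hc, hn⟩ := h
  exact ⟨f v, c.map f, (SimpleGraph.Walk.isCycle_map_iff_of_injective hf).2 hc, by simpa using hn⟩

namespace Cfg4

/-- In a minimum counterexample, a proper part of the graph can be colored from any lists
satisfying the hypotheses of the theorem. -/
lemma MinCounterexample.exists_coloring_on {C : Cfg4} (hC : C.MinCounterexample)
    {S : Set (Fin C.n)} (hS : S ≠ univ) {H : SimpleGraph (Fin C.n)} (hH : H ≤ C.G)
    {P : List (Fin C.n)} {L : Fin C.n → Finset ℕ} {D X : Set (ℝ × ℝ)}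
    (hD : D = C.E.part (· ∈ S) (fun a b => H.Adj a b ∧ a ∈ S ∧ b ∈ S)) {q : ℝ × ℝ} (hq : q ∈ C.F)
    (hX : X = connectedComponentIn Dᶜ q) (hnd : P.Nodup) (hlen : P.length ≤ 3)
    (hPS : ∀ v ∈ P, v ∈ S) (hPX : ∀ v ∈ P, C.E.pos v ∈ closure X)
    (hchain : P.IsChain fun a b => H.Adj a b ∧ seg (C.E.pos a) (C.E.pos b) ⊆ closure X)
    (hinter : ∀ u ∈ S, ∀ v ∈ S, H.Adj u v → (L u ∩ L v).card ≤ 1)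
    (h3 : ∀ v ∈ S, C.E.pos v ∉ closure X → 3 ≤ (L v).card)
    (h2 : ∀ v ∈ S, v ∉ P → 2 ≤ (L v).card)
    (h1 : ∀ v ∈ P, (L v).card = 1)
    (hadj2 : ∀ u ∈ S, ∀ v ∈ S, H.Adj u v → (L u).card = 2 → (L v).card ≠ 2)
    (hcol : ∃ φ : Fin C.n → ℕ, (∀ v ∈ P, φ v ∈ L v) ∧
      ∀ u ∈ P, ∀ v ∈ P, H.Adj u v → φ u ≠ φ v)
    (htwo : ∀ x ∈ S, (L x).card = 2 → ∀ u ∈ P, ∀ v ∈ P, u ≠ v → H.Adj x u → H.Adj x v → False) :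
    ∃ φ : Fin C.n → ℕ, (∀ v ∈ S, φ v ∈ L v) ∧
      ∀ u ∈ S, ∀ v ∈ S, H.Adj u v → φ u ≠ φ v := by
  classical
  let e := Finite.equivFin S
  let ι : Fin (Nat.card S) → Fin C.n := fun i => (e.symm i : Fin C.n)
  have hι : Function.Injective ι := Subtype.val_injective.comp e.symm.injective
  have hιS : ∀ i, ι i ∈ S := fun i => (e.symm i).2
  have hsurj : ∀ v ∈ S, ∃ i, ι i = v := fun v hv => ⟨e ⟨v, hv⟩, congrArg Subtype.val (e.symm_apply_apply _)⟩
  let f : H.comap ι →g C.G := ⟨ι, fun h => hH h⟩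
  have hcard : Nat.card S < C.n := by
    rw [Nat.card_coe_set_eq]
    simpa using Set.ncard_lt_card hS
  obtain ⟨P₁, hP₁⟩ : P ∈ Set.range (List.map ι) := by
    rw [Set.range_list_map]
    exact fun v hv => hsurj v (hPS v hv)
  have hmemP : ∀ i, i ∈ P₁ ↔ ι i ∈ P := by
    intro i
    rw [← hP₁, List.mem_map_of_injective hι]
  have hdraw : (C.E.restrict f hι).drawing = D := by
    ext z
    rw [PlaneEmb.mem_drawing_iff, hD]
    constructor
    · rintro (⟨i, rfl⟩ | ⟨i, j, hij, hz⟩)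
      · exact Or.inl ⟨ι i, hιS i, rfl⟩
      · exact Or.inr ⟨ι i, ι j, ⟨hij, hιS i, hιS j⟩, hz⟩
    · rintro (⟨v, hv, rfl⟩ | ⟨u, v, ⟨huv, hu, hv⟩, hz⟩)
      · obtain ⟨i, rfl⟩ := hsurj v hv
        exact Or.inl ⟨i, rfl⟩
      · obtain ⟨i, rfl⟩ := hsurj u hu
        obtain ⟨j, rfl⟩ := hsurj v hv
        exact Or.inr ⟨i, j, huv, hz⟩
  obtain ⟨hval, hncol, hmin⟩ := hC
  obtain ⟨hc4, hF, -⟩ := hval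
  have hDF : D ⊆ C.Fᶜ := by
    rw [hD]
    exact (PlaneEmb.part_subset_drawing fun a b h => hH h.1).trans
      (PlaneEmb.drawing_subset_compl hF.1)
  have hFX : C.F ⊆ X := by
    have hFc : IsPreconnected C.F := by
      obtain ⟨⟨q, _, h⟩, -⟩ := hF
      rw [h]
      exact isPreconnected_connectedComponentIn
    rw [hX]
    exact hFc.subset_connectedComponentIn hq fun z hz hzD => hDF hzD hz
  let B : Cfg4 := ⟨Nat.card S, H.comap ι, C.E.restrict f hι, X, P₁, L ∘ ι⟩
  have hBval : B.Valid := by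
    refine ⟨fun h => hc4 (h.map f hι), ⟨⟨q, ?_, ?_⟩, fun h => hF.2 (h.subset hFX)⟩, ?_, ?_, ?_, ?_,
      ?_, ?_, ?_, ?_, ?_, ?_, ?_, ?_⟩
    · rw [hdraw]
      exact fun h => hDF h hq
    · rw [hdraw]
      exact hX
    · exact List.Nodup.of_map ι (hP₁ ▸ hnd)
    · rw [← hP₁, List.length_map] at hlen
      exact hlen
    · exact fun i hi => hPX _ ((hmemP i).1 hi)
    · rw [← hP₁, List.isChain_map] at hchain
      exact hchain
    · intro i
      by_cases hi : ι i ∈ P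
      · exact (h1 _ hi).ge
      · exact le_trans one_le_two (h2 _ (hιS i) hi)
    · exact fun i j hij => hinter _ (hιS i) _ (hιS j) hij
    · exact fun i hi => h3 _ (hιS i) hi
    · exact fun i _ hi => h2 _ (hιS i) fun h => hi ((hmemP i).2 h)
    · exact fun i hi => h1 _ ((hmemP i).1 hi)
    · exact fun i j hij => hadj2 _ (hιS i) _ (hιS j) hij
    · obtain ⟨φ, hφ, hφ'⟩ := hcol
      exact ⟨φ ∘ ι, fun i hi => hφ _ ((hmemP i).1 hi), fun i j hi hj hij =>
        hφ' _ ((hmemP i).1 hi) _ ((hmemP j).1 hj) hij⟩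
    · exact fun i hi u hu v hv huv h1 h2 => htwo _ (hιS i) hi _ ((hmemP u).1 hu) _
        ((hmemP v).1 hv) (hι.ne huv) h1 h2
  have hBcol : B.Colorable := by
    by_contra hn
    have h1 := (hmin B hBval hn).1
    have h2 : Nat.card B.G.edgeSet ≤ Nat.card C.G.edgeSet :=
      Nat.card_le_card_of_injective _ (SimpleGraph.Hom.mapEdgeSet.injective f hι)
    have h3 : B.n = Nat.card S := rfl
    unfold measure at h1
    omega
  obtain ⟨φ, hφ, hφ'⟩ := hBcol
  refine ⟨Function.extend ι φ 0, ?_, ?_⟩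
  · intro v hv
    obtain ⟨i, rfl⟩ := hsurj v hv
    rw [hι.extend_apply]
    exact hφ i
  · intro u hu v hv huv
    obtain ⟨i, rfl⟩ := hsurj u hu
    obtain ⟨j, rfl⟩ := hsurj v hv
    rw [hι.extend_apply, hι.extend_apply]
    exact hφ' huv

/-- A minimum counterexample has no separating 2-chord `v0 v1 v2` with `|L(v2)| = 2` for which no
other vertex with a list of size two is adjacent to both `v0` and `v1`. -/
lemma MinCounterexample.not_isSep2Chord {C : Cfg4} (hC : C.MinCounterexample) {v0 v1 v2 : Fin C.n}
    (hsep : C.IsSep2Chord v0 v1 v2) (hcard : (C.L v2).card = 2) (hmid : ¬ C.IsMiddle v0)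
    (hvi : ∀ x, (C.L x).card = 2 → x ∉ ({v0, v1, v2} : Set (Fin C.n)) → C.G.Adj x v0 →
      C.G.Adj x v1 → False) : False := by
  classical
  obtain ⟨⟨h01, h12, hne, hv0, hv2, hv1⟩, hb⟩ := hsep
  obtain ⟨-, hF, hnd, hlen, hPF, hchain, -, hinter, h3, h2, h1, hadj2, hcol, htwo⟩ := hC.1
  replace hchain : C.P.IsChain (C.E.BoundaryEdge C.F) := hchain
  obtain ⟨σ, hσ, hσne, hσcl⟩ := PlaneEmb.exists_sides hF h01 h12 hne hv0 hv2 hv1 hb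
  obtain ⟨q, hq⟩ : C.F.Nonempty := by
    obtain ⟨⟨q, hq, h⟩, -⟩ := hF
    exact ⟨q, h ▸ mem_connectedComponentIn hq⟩
  have hFc : IsPreconnected C.F := by
    obtain ⟨⟨q, _, h⟩, -⟩ := hF
    rw [h]
    exact isPreconnected_connectedComponentIn
  set Q : Set (Fin C.n) := {v0, v1, v2} with hQ
  have hPQ : ∃ s, ∀ v ∈ C.P, v ∉ Q → σ v ≠ s := by
    by_contra! hcon
    obtain ⟨a, ha, haQ, hσa⟩ := hcon true
    obtain ⟨b, hbP, hbQ, hσb⟩ := hcon false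
    have hexists : ∃ y ∈ C.P, (y ∈ Q → C.IsMiddle y) ∧
        ∀ w ∈ C.P, w = y ∨ C.G.Adj w y := by
      rcases hP : C.P with _ | ⟨x, _ | ⟨y, _ | ⟨z, _ | ⟨w, l⟩⟩⟩⟩
      · simp [hP] at ha
      · simp only [hP, List.mem_singleton] at ha hbP
        rw [ha, ← hbP, hσb] at hσa
        simp at hσa
      · simp only [hP, List.isChain_cons_cons] at hchain
        simp only [hP, List.mem_cons, List.not_mem_nil, or_false] at ha hbP
        have hyQ : y ∉ Q := by
          rcases ha with rfl | rfl
          · rcases hbP with rfl | rfl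
            · simp [hσa] at hσb
            · exact hbQ
          · exact haQ
        refine ⟨y, by simp, fun h => absurd h hyQ, ?_⟩
        simp only [List.mem_cons, List.not_mem_nil, or_false]
        rintro w (rfl | rfl)
        · exact Or.inr hchain.1.1
        · exact Or.inl rfl
      · simp only [hP, List.isChain_cons_cons] at hchain
        refine ⟨y, by simp, fun _ => ⟨x, z, hP⟩, ?_⟩
        simp only [List.mem_cons, List.not_mem_nil, or_false]
        rintro w (rfl | rfl | rfl)
        · exact Or.inr hchain.1.1
        · exact Or.inl rfl
        · exact Or.inr hchain.2.1.1.symm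
      · simp only [hP, List.length_cons] at hlen
        omega
    obtain ⟨y, hyP, hym, hy⟩ := hexists
    by_cases hyQ : y ∈ Q
    · have hm := hym hyQ
      rcases hyQ with rfl | rfl | rfl
      · exact hmid hm
      · exact hv1 (hPF _ hyP)
      · have := h1 _ hyP
        omega
    · have key : ∀ w ∈ C.P, w ∉ Q → σ w = σ y := by
        intro w hw hwQ
        rcases hy w hw with rfl | h
        · rfl
        · exact hσ _ _ h hwQ hyQ
      rw [key a ha haQ, ← key b hbP hbQ, hσb] at hσa
      simp at hσa
  obtain ⟨s, hs⟩ := hPQ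
  have hnot : ∀ v, σ v = s ∨ σ v = !s := fun v => by cases s <;> cases σ v <;> simp
  have hmono : ∀ {D : Set (ℝ × ℝ)}, D ⊆ C.E.drawing →
      C.F ⊆ connectedComponentIn Dᶜ q := fun hD =>
    hFc.subset_connectedComponentIn hq fun z hz hzD => PlaneEmb.isFace_disjoint hF.1 hz (hD hzD)
  obtain ⟨φ, hφ, hφ'⟩ : ∃ φ : Fin C.n → ℕ, (∀ v ∈ {v | v ∈ Q ∨ σ v = !s}, φ v ∈ C.L v) ∧
      ∀ u ∈ {v | v ∈ Q ∨ σ v = !s}, ∀ v ∈ {v | v ∈ Q ∨ σ v = !s}, C.G.Adj u v → φ u ≠ φ v := by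
    have hcl := closure_mono (hmono (PlaneEmb.part_subset_drawing (E := C.E)
      (S := (· ∈ {v | v ∈ Q ∨ σ v = !s}))
      (R := fun a b => C.G.Adj a b ∧ a ∈ {v | v ∈ Q ∨ σ v = !s} ∧ b ∈ {v | v ∈ Q ∨ σ v = !s})
      fun a b h => h.1))
    refine hC.exists_coloring_on ?_ le_rfl rfl hq rfl hnd hlen ?_ (fun v hv => hcl (hPF v hv)) ?_
      (fun u _ v _ h => hinter h) (fun v _ hv => h3 v fun h => hv (hcl h)) ?_ h1
      (fun u _ v _ h => hadj2 h) ?_ (fun x _ => htwo x)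
    · obtain ⟨v, hvQ, hv⟩ := hσne s
      refine (ne_univ_iff_exists_notMem _).2 ⟨v, ?_⟩
      rintro (h | h)
      · exact hvQ h
      · simp [hv] at h
    · intro v hv
      by_cases hvQ : v ∈ Q
      · exact Or.inl hvQ
      · exact Or.inr ((hnot v).resolve_left (hs v hv hvQ))
    · exact hchain.imp fun a b h => ⟨h.1, h.2.trans hcl⟩
    · intro v _ hv
      by_cases hvF : v ∈ C.E.onFace C.F
      · exact h2 v hvF hv
      · exact le_trans (by norm_num) (h3 v hvF)
    · obtain ⟨φ, hφ, hφ'⟩ := hcol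
      exact ⟨φ, hφ, fun u hu v hv h => hφ' hu hv h⟩
  have hφQ : ∀ u ∈ Q, ∀ v ∈ Q, C.G.Adj u v → φ u ≠ φ v :=
    fun u hu v hv => hφ' u (Or.inl hu) v (Or.inl hv)
  obtain ⟨ψ, hψ, hψ'⟩ : ∃ ψ : Fin C.n → ℕ, (∀ v ∈ {v | v ∈ Q ∨ σ v = s},
        ψ v ∈ (fun v => if v ∈ Q then {φ v} else C.L v) v) ∧
      ∀ u ∈ {v | v ∈ Q ∨ σ v = s}, ∀ v ∈ {v | v ∈ Q ∨ σ v = s},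
        (C.G.deleteEdges {s(v0, v2)}).Adj u v → ψ u ≠ ψ v := by
    set D := C.E.part (· ∈ {v | v ∈ Q ∨ σ v = s})
      (fun a b => (C.G.deleteEdges {s(v0, v2)}).Adj a b ∧ a ∈ {v | v ∈ Q ∨ σ v = s} ∧
        b ∈ {v | v ∈ Q ∨ σ v = s}) with hD
    have hdel : ∀ {a b}, (C.G.deleteEdges {s(v0, v2)}).Adj a b ↔
        C.G.Adj a b ∧ s(a, b) ≠ s(v0, v2) := by
      intro a b
      rw [SimpleGraph.deleteEdges_adj, mem_singleton_iff]
    have hv0Q : v0 ∈ Q := Or.inl rfl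
    have hv1Q : v1 ∈ Q := Or.inr (Or.inl rfl)
    have hv2Q : v2 ∈ Q := Or.inr (Or.inr rfl)
    have hs1 : s(v0, v1) ≠ s(v0, v2) := by
      intro h
      rcases Sym2.eq_iff.1 h with ⟨-, h⟩ | ⟨h, -⟩
      · exact h12.ne h
      · exact hne h
    have hs2 : s(v1, v2) ≠ s(v0, v2) := by
      intro h
      rcases Sym2.eq_iff.1 h with ⟨h, -⟩ | ⟨h, -⟩
      · exact h01.ne' h
      · exact h12.ne h
    have hcl := closure_mono (hmono (D := D) (PlaneEmb.part_subset_drawing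
      fun a b h => (hdel.1 h.1).1))
    have hTcl := hσcl s D (C.E.isClosed_part _ _) (union_subset
      (fun z hz => Or.inr ⟨v0, v1, ⟨hdel.2 ⟨h01, hs1⟩, Or.inl hv0Q, Or.inl hv1Q⟩, hz⟩)
      (fun z hz => Or.inr ⟨v1, v2, ⟨hdel.2 ⟨h12, hs2⟩, Or.inl hv1Q, Or.inl hv2Q⟩, hz⟩)) (by
        rintro z (h | ⟨a, b, ⟨hab, ha, hb⟩, hz⟩)
        · exact Or.inl h
        · exact Or.inr ⟨a, b, ⟨(hdel.1 hab).1, ha, hb, (hdel.1 hab).2⟩, hz⟩) q hq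
    obtain ⟨hT1, hT2⟩ := union_subset_iff.1 hTcl
    have hQcl : ∀ v ∈ Q, C.E.pos v ∈ closure (connectedComponentIn Dᶜ q) := by
      rintro v (rfl | rfl | rfl)
      · exact hT1 (left_mem_seg _ _)
      · exact hT1 (right_mem_seg _ _)
      · exact hT2 (right_mem_seg _ _)
    have hPmem : ∀ v, v ∈ [v0, v1, v2] ↔ v ∈ Q := by
      intro v
      simp [hQ]
    have hone : ∀ {v}, v ∈ Q → (if v ∈ Q then {φ v} else C.L v : Finset ℕ).card = 1 := by
      intro v hv
      simp [hv]
    refine hC.exists_coloring_on (P := [v0, v1, v2]) ?_ (SimpleGraph.deleteEdges_le _) hD hq rfl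
      (by simp [h01.ne, h12.ne, hne]) (by simp) (fun v hv => Or.inl ((hPmem v).1 hv))
      (fun v hv => hQcl v ((hPmem v).1 hv)) ?_ ?_ ?_ ?_ (fun v hv => hone ((hPmem v).1 hv)) ?_
      ⟨φ, ?_, ?_⟩ ?_
    · obtain ⟨v, hvQ, hv⟩ := hσne (!s)
      refine (ne_univ_iff_exists_notMem _).2 ⟨v, ?_⟩
      rintro (h | h)
      · exact hvQ h
      · simp [hv] at h
    · simp only [List.isChain_cons_cons, List.isChain_singleton, and_true]
      exact ⟨⟨hdel.2 ⟨h01, hs1⟩, hT1⟩, hdel.2 ⟨h12, hs2⟩, hT2⟩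
    · intro u _ v _ huv
      by_cases hu : u ∈ Q
      · exact (Finset.card_le_card Finset.inter_subset_left).trans (hone hu).le
      · by_cases hv : v ∈ Q
        · exact (Finset.card_le_card Finset.inter_subset_right).trans (hone hv).le
        · simpa only [if_neg hu, if_neg hv] using hinter (hdel.1 huv).1
    · intro v _ hv
      have hvQ : v ∉ Q := fun h => hv (hQcl v h)
      simpa only [if_neg hvQ] using h3 v fun h => hv (hcl h)
    · intro v hvS hv
      have hvQ : v ∉ Q := fun h => hv ((hPmem v).2 h)
      have hvP : v ∉ C.P := fun h => hs v h hvQ (hvS.resolve_left hvQ)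
      simp only [if_neg hvQ]
      by_cases hvF : v ∈ C.E.onFace C.F
      · exact h2 v hvF hvP
      · exact le_trans (by norm_num) (h3 v hvF)
    · intro u _ v _ huv hu hv
      have huQ : u ∉ Q := fun h => by
        rw [hone h] at hu
        omega
      have hvQ : v ∉ Q := fun h => by
        rw [hone h] at hv
        omega
      simp only [if_neg huQ, if_neg hvQ] at hu hv
      exact hadj2 (hdel.1 huv).1 hu hv
    · intro v hv
      simp [(hPmem v).1 hv]
    · exact fun u hu v hv huv => hφQ u ((hPmem u).1 hu) v ((hPmem v).1 hv) (hdel.1 huv).1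
    · intro x _ hx u hu v hv huv hxu hxv
      have hxQ : x ∉ Q := fun h => by
        rw [hone h] at hx
        omega
      simp only [if_neg hxQ] at hx
      replace hxu := (hdel.1 hxu).1
      replace hxv := (hdel.1 hxv).1
      have hx2 : ¬ C.G.Adj x v2 := fun h => hadj2 h hx hcard
      rcases (hPmem u).1 hu with rfl | rfl | rfl
      · rcases (hPmem v).1 hv with rfl | rfl | rfl
        · exact huv rfl
        · exact hvi x hx hxQ hxu hxv
        · exact hx2 hxv
      · rcases (hPmem v).1 hv with rfl | rfl | rfl
        · exact hvi x hx hxQ hxv hxu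
        · exact huv rfl
        · exact hx2 hxv
      · exact hx2 hxu
  have hψQ : ∀ v ∈ Q, ψ v = φ v := by
    intro v hv
    simpa [hv] using hψ v (Or.inl hv)
  refine hC.2.1 ⟨fun v => if v ∈ Q ∨ σ v = !s then φ v else ψ v, ?_, ?_⟩
  · intro v
    by_cases hv : v ∈ Q ∨ σ v = !s
    · simpa only [if_pos hv] using hφ v hv
    · have hvs : σ v = s := (hnot v).resolve_right fun h => hv (Or.inr h)
      have hvQ : v ∉ Q := fun h => hv (Or.inl h)
      simpa only [if_neg hv, if_neg hvQ] using hψ v (Or.inr hvs)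
  · have hmixed : ∀ {u v}, C.G.Adj u v → (u ∈ Q ∨ σ u = !s) → ¬ (v ∈ Q ∨ σ v = !s) →
        φ u ≠ ψ v := by
      intro u v huv hu hv
      have hvs : σ v = s := (hnot v).resolve_right fun h => hv (Or.inr h)
      have hvQ : v ∉ Q := fun h => hv (Or.inl h)
      have huQ : u ∈ Q := by
        by_contra huQ
        refine hv (Or.inr ?_)
        rw [← hσ u v huv huQ hvQ]
        exact hu.resolve_left huQ
      rw [← hψQ u huQ]
      refine hψ' u (Or.inl huQ) v (Or.inr hvs) ?_
      rw [SimpleGraph.deleteEdges_adj, mem_singleton_iff]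
      refine ⟨huv, fun h => hvQ ?_⟩
      rcases Sym2.eq_iff.1 h with ⟨-, h⟩ | ⟨-, h⟩
      · exact Or.inr (Or.inr h)
      · exact Or.inl h
    intro u v huv
    by_cases hu : u ∈ Q ∨ σ u = !s <;> by_cases hv : v ∈ Q ∨ σ v = !s
    · simpa only [if_pos hu, if_pos hv] using hφ' u hu v hv huv
    · simpa only [if_pos hu, if_neg hv] using hmixed huv hu hv
    · simpa only [if_neg hu, if_pos hv] using (hmixed huv.symm hv hu).symm
    · simp only [if_neg hu, if_neg hv]
      have hus : σ u = s := (hnot u).resolve_right fun h => hu (Or.inr h)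
      have hvs : σ v = s := (hnot v).resolve_right fun h => hv (Or.inr h)
      refine hψ' u (Or.inr hus) v (Or.inr hvs) ?_
      rw [SimpleGraph.deleteEdges_adj, mem_singleton_iff]
      refine ⟨huv, fun h => ?_⟩
      rcases Sym2.eq_iff.1 h with ⟨h, -⟩ | ⟨h, -⟩
      · exact hu (Or.inl (Or.inl h))
      · exact hu (Or.inl (Or.inr (Or.inr h)))

end Cfg4

/-- **Claim 7 in the proof of Theorem 6.** In a minimum counterexample to Theorem 6,
the outer cycle has no separating 2-chord `v0 v1 v2` with `|L(v2)| = 2` where `v0` is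
not a middle vertex. -/
theorem min_cex_C4free_no_sep_2chord (C : Cfg4) (hC : C.MinCounterexample) :
    ¬ ∃ v0 v1 v2 : Fin C.n, C.IsSep2Chord v0 v1 v2 ∧ (C.L v2).card = 2 ∧
      ¬ C.IsMiddle v0 := by
  rintro ⟨v0, v1, v2, hsep, hcard, hmid⟩
  refine hC.not_isSep2Chord hsep hcard hmid fun x hx hxQ hx0 hx1 => ?_
  obtain ⟨⟨-, h12, -, -, hv2, hv1⟩, -⟩ := hsep
  obtain ⟨-, -, -, -, -, -, -, -, h3, -, h1, hadj2, -⟩ := hC.1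
  simp only [mem_insert_iff, mem_singleton_iff, not_or] at hxQ
  have hxF : x ∈ C.E.onFace C.F := by
    by_contra h
    have := h3 x h
    omega
  refine hC.not_isSep2Chord (v0 := x) ⟨⟨hx1, h12, hxQ.2.2, hxF, hv2, hv1⟩,
    fun h => hadj2 h.1 hx hcard⟩ hcard ?_ fun y hy _ hyx _ => hadj2 hyx hy hx
  rintro ⟨a, b, hP⟩
  have := h1 x (by simp [hP])
  omega

end ChoosSep
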